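/- arXiv:1103.6184 — 2 statements merged into one kernel-verified Lean document; each statement's English description precedes it below -/
import Mathlib

section
/- Let n ≥ 2 and α ∈ ℝ. Then the best constant in the Rellich inequality on ℝⁿ∖{0}, namely μ_{n,α} := inf{ ∫_{ℝⁿ} |x|^α |Δu|² dx / ∫_{ℝⁿ} |x|^{α−4} |u|² dx : u ∈ C²_c(ℝⁿ∖{0}), u ≠ 0 }, equals min over integers k ≥ 0 of |γ_{n,α} + k(n−2+k)|². In particular, ∫_{ℝⁿ} |x|^α |Δu|² dx ≥ μ_{n,α} ∫_{ℝⁿ} |x|^{α−4} |u|² dx for every u ∈ C²_c(ℝⁿ∖{0}), and μ_{n,α} is the largest constant for which this holds. -/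
open MeasureTheory Metric Set Filter
open scoped RealInnerProductSpace

noncomputable section

/-- The Euclidean Laplacian of `u : ℝⁿ → ℝ` at a point. -/
def lap {n : ℕ} (u : EuclideanSpace ℝ (Fin n) → ℝ) (x : EuclideanSpace ℝ (Fin n)) : ℝ :=
  ∑ i : Fin n, iteratedFDeriv ℝ 2 u x ![EuclideanSpace.single i 1, EuclideanSpace.single i 1]

/-- The Laplace–Beltrami operator on the unit sphere, computed via the
`0`-homogeneous extension: for a `0`-homogeneous function the Euclidean Laplacian
restricted to the unit sphere is exactly the Laplace–Beltrami operator. -/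
def sphLap {n : ℕ} (φ : EuclideanSpace ℝ (Fin n) → ℝ) (σ : EuclideanSpace ℝ (Fin n)) : ℝ :=
  lap (fun x => φ (‖x‖⁻¹ • x)) σ

/-- Squared norm of the spherical gradient, via the `0`-homogeneous extension. -/
def sphGradNormSq {n : ℕ} (φ : EuclideanSpace ℝ (Fin n) → ℝ) (σ : EuclideanSpace ℝ (Fin n)) : ℝ :=
  ‖fderiv ℝ (fun x => φ (‖x‖⁻¹ • x)) σ‖ ^ 2

/-- The open cone `C_Σ = {rσ : r > 0, σ ∈ Σ}` over a subset of the unit sphere. -/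
def coneOf {n : ℕ} (S : Set (EuclideanSpace ℝ (Fin n))) : Set (EuclideanSpace ℝ (Fin n)) :=
  {x | x ≠ 0 ∧ ‖x‖⁻¹ • x ∈ S}

/-- The canonical surface measure `dσ` on the unit sphere of `ℝⁿ`, as a measure on `ℝⁿ`. -/
def sphMeasure (n : ℕ) : Measure (EuclideanSpace ℝ (Fin n)) :=
  Measure.map Subtype.val
    ((volume : Measure (EuclideanSpace ℝ (Fin n))).toSphere)

/-- A (Dirichlet) eigenfunction of the Laplace–Beltrami operator on `S ⊆ 𝕊^{n-1}`
relative to the eigenvalue `lam`. -/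
def IsEigenfun {n : ℕ} (S : Set (EuclideanSpace ℝ (Fin n))) (lam : ℝ)
    (φ : EuclideanSpace ℝ (Fin n) → ℝ) : Prop :=
  ContinuousOn (fun x => φ (‖x‖⁻¹ • x)) (coneOf (closure S)) ∧
  ContDiffOn ℝ 2 (fun x => φ (‖x‖⁻¹ • x)) (coneOf S) ∧
  (∀ σ ∈ closure S \ S, φ σ = 0) ∧
  (∃ σ ∈ S, φ σ ≠ 0) ∧
  (∀ σ ∈ S, - sphLap φ σ = lam * φ σ)

/-- The Dirichlet spectrum `Λ(Σ)` of the Laplace–Beltrami operator on `S`. -/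
def spec {n : ℕ} (S : Set (EuclideanSpace ℝ (Fin n))) : Set ℝ :=
  {lam | ∃ φ, IsEigenfun S lam φ}

/-- `S` is a domain in the unit sphere `𝕊^{n-1}`: a relatively open connected
nonempty subset. -/
def IsSphDomain {n : ℕ} (S : Set (EuclideanSpace ℝ (Fin n))) : Prop :=
  S ⊆ Metric.sphere (0 : EuclideanSpace ℝ (Fin n)) 1 ∧
  IsOpen (Subtype.val ⁻¹' S : Set (Metric.sphere (0 : EuclideanSpace ℝ (Fin n)) 1)) ∧
  IsConnected S

/-- `S` is a domain of class `C²` in the unit sphere: a domain such that the cone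
over it admits local `C²` defining functions away from the origin. -/
def IsC2SphDomain {n : ℕ} (S : Set (EuclideanSpace ℝ (Fin n))) : Prop :=
  IsSphDomain S ∧
  ∀ x ∈ frontier (coneOf S) \ {0}, ∃ (U : Set (EuclideanSpace ℝ (Fin n)))
    (f : EuclideanSpace ℝ (Fin n) → ℝ), IsOpen U ∧ x ∈ U ∧ ContDiff ℝ 2 f ∧
    fderiv ℝ f x ≠ 0 ∧ coneOf S ∩ U = {y ∈ U | f y < 0}

/-- `γ_{n,α} = ((n-2)/2)² - ((α-2)/2)²`. -/
def gam (n : ℕ) (α : ℝ) : ℝ := (((n : ℝ) - 2) / 2) ^ 2 - ((α - 2) / 2) ^ 2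

/-- `γ̄_{n,α} = ((n-2)/2)² + ((α-2)/2)²`. -/
def gbar (n : ℕ) (α : ℝ) : ℝ := (((n : ℝ) - 2) / 2) ^ 2 + ((α - 2) / 2) ^ 2

/-- The class `C²_c(Ω̄ ∖ {0})` of Navier test functions: `C²` up to the closure of
`Ω`, vanishing on `∂Ω` and in a neighborhood of `0` and of `∞`. -/
def NavierAdm {n : ℕ} (Ω : Set (EuclideanSpace ℝ (Fin n)))
    (u : EuclideanSpace ℝ (Fin n) → ℝ) : Prop :=
  ContDiffOn ℝ 2 u (closure Ω) ∧
  (∀ x ∈ frontier Ω, u x = 0) ∧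
  (∃ ε > 0, ∀ x : EuclideanSpace ℝ (Fin n), ‖x‖ < ε → u x = 0) ∧
  (∃ R : ℝ, ∀ x : EuclideanSpace ℝ (Fin n), R < ‖x‖ → u x = 0)

/-- The class `C²_c(Ω)` of Dirichlet test functions: globally `C²` with compact
support contained in `Ω`. -/
def DirichletAdm {n : ℕ} (Ω : Set (EuclideanSpace ℝ (Fin n)))
    (u : EuclideanSpace ℝ (Fin n) → ℝ) : Prop :=
  ContDiff ℝ 2 u ∧ HasCompactSupport u ∧ tsupport u ⊆ Ω

/-- The best Rellich constant `μ_N(Ω;α)` under Navier boundary conditions. -/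
def muN {n : ℕ} (Ω : Set (EuclideanSpace ℝ (Fin n))) (α : ℝ) : ℝ :=
  sInf {q : ℝ | ∃ u, NavierAdm Ω u ∧ (∃ x ∈ Ω, u x ≠ 0) ∧
    q = (∫ x in Ω, ‖x‖ ^ α * (lap u x) ^ 2) / (∫ x in Ω, ‖x‖ ^ (α - 4) * (u x) ^ 2)}

/-- The best Rellich constant `μ_D(Ω;α)` under Dirichlet boundary conditions. -/
def muD {n : ℕ} (Ω : Set (EuclideanSpace ℝ (Fin n))) (α : ℝ) : ℝ :=
  sInf {q : ℝ | ∃ u, DirichletAdm Ω u ∧ (∃ x ∈ Ω, u x ≠ 0) ∧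
    q = (∫ x in Ω, ‖x‖ ^ α * (lap u x) ^ 2) / (∫ x in Ω, ‖x‖ ^ (α - 4) * (u x) ^ 2)}

/-- The surrogate of `H² ∩ H¹₀(Σ)`: functions whose `0`-homogeneous extension is
`C²` up to the closure of the cone, vanishing on the relative boundary of `S`. -/
def NavAdmS {n : ℕ} (S : Set (EuclideanSpace ℝ (Fin n)))
    (φ : EuclideanSpace ℝ (Fin n) → ℝ) : Prop :=
  ContDiffOn ℝ 2 (fun x => φ (‖x‖⁻¹ • x)) (coneOf (closure S)) ∧
  (∀ σ ∈ closure S \ S, φ σ = 0)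

/-- The surrogate of `H²₀(Σ)`: as `NavAdmS`, with in addition vanishing gradient
on the relative boundary of `S`. -/
def DirAdmS {n : ℕ} (S : Set (EuclideanSpace ℝ (Fin n)))
    (φ : EuclideanSpace ℝ (Fin n) → ℝ) : Prop :=
  NavAdmS S φ ∧
  ∀ σ ∈ closure S \ S,
    fderivWithin ℝ (fun x => φ (‖x‖⁻¹ • x)) (coneOf (closure S)) σ = 0

/-- The Rayleigh-type quotient `∫_Σ |Lφ|² dσ / ∫_Σ |φ|² dσ` with
`Lφ = -Δ_σ φ + γ φ`. -/
def sphQuot {n : ℕ} (S : Set (EuclideanSpace ℝ (Fin n))) (γ : ℝ)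
    (φ : EuclideanSpace ℝ (Fin n) → ℝ) : ℝ :=
  (∫ σ in S, (- sphLap φ σ + γ * φ σ) ^ 2 ∂(sphMeasure n)) /
    (∫ σ in S, (φ σ) ^ 2 ∂(sphMeasure n))

/-- Partial derivative `w_s` of a function on the cylinder `ℝ × 𝕊^{n-1}`. -/
def ws {n : ℕ} (w : ℝ × EuclideanSpace ℝ (Fin n) → ℝ)
    (p : ℝ × EuclideanSpace ℝ (Fin n)) : ℝ :=
  deriv (fun t => w (t, p.2)) p.1

/-- Second partial derivative `w_ss` of a function on the cylinder. -/
def wss {n : ℕ} (w : ℝ × EuclideanSpace ℝ (Fin n) → ℝ)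
    (p : ℝ × EuclideanSpace ℝ (Fin n)) : ℝ :=
  deriv (fun t => ws w (t, p.2)) p.1

end

noncomputable section

/-- The set of Rellich quotients over nonzero `u ∈ C²_c(ℝⁿ ∖ {0})`. -/
def RellichRatioSet (n : ℕ) (α : ℝ) : Set ℝ :=
  {q : ℝ | ∃ u : EuclideanSpace ℝ (Fin n) → ℝ,
    DirichletAdm {(0 : EuclideanSpace ℝ (Fin n))}ᶜ u ∧ (∃ x, u x ≠ 0) ∧
    q = (∫ x, ‖x‖ ^ α * (lap u x) ^ 2) / (∫ x, ‖x‖ ^ (α - 4) * (u x) ^ 2)}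

set_option linter.unusedSimpArgs false
set_option linter.unusedVariables false

/-- evaluation of a polynomial at a point of Euclidean space -/
noncomputable def ev {n : ℕ} (p : MvPolynomial (Fin n) ℝ) (x : EuclideanSpace ℝ (Fin n)) : ℝ :=
  MvPolynomial.eval (fun i => x i) p

/-- algebraic Laplacian -/
noncomputable def plap {n : ℕ} : MvPolynomial (Fin n) ℝ →ₗ[ℝ] MvPolynomial (Fin n) ℝ :=
  ∑ i, (MvPolynomial.pderiv i).toLinearMap ∘ₗ (MvPolynomial.pderiv i).toLinearMap

lemma plap_apply {n : ℕ} (p : MvPolynomial (Fin n) ℝ) :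
    plap p = ∑ i, MvPolynomial.pderiv i (MvPolynomial.pderiv i p) := by
  simp [plap]

lemma ev_hasFDerivAt {n : ℕ} (p : MvPolynomial (Fin n) ℝ) (x : EuclideanSpace ℝ (Fin n)) :
    HasFDerivAt (ev p) (∑ i, ev (MvPolynomial.pderiv i p) x •
      (EuclideanSpace.proj i : EuclideanSpace ℝ (Fin n) →L[ℝ] ℝ)) x := by
  induction p using MvPolynomial.induction_on with
  | C a =>
    have : ev (MvPolynomial.C a : MvPolynomial (Fin n) ℝ) = fun _ => a := by
      ext y; simp [ev]
    rw [this]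
    convert hasFDerivAt_const a x using 1
    ext v; simp [ev]
  | add p q hp hq =>
    have : ev (p + q) = fun y => ev p y + ev q y := by
      ext y; simp [ev]
    rw [this]
    refine (hp.add hq).congr_fderiv ?_
    ext v; simp [ev, add_mul, Finset.sum_add_distrib]
  | mul_X p j hp =>
    have : ev (p * MvPolynomial.X j) = fun y => ev p y * (EuclideanSpace.proj j : EuclideanSpace ℝ (Fin n) →L[ℝ] ℝ) y := by
      ext y; simp [ev]
    rw [this]
    refine (hp.mul (EuclideanSpace.proj j : EuclideanSpace ℝ (Fin n) →L[ℝ] ℝ).hasFDerivAt).congr_fderiv ?_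
    ext v
    simp [ev, MvPolynomial.pderiv_X, Pi.single_apply, add_mul, Finset.sum_add_distrib, Finset.mul_sum, apply_ite]
    congr 1
    funext i; ring

lemma ev_contDiff {n : ℕ} (p : MvPolynomial (Fin n) ℝ) {m : WithTop ℕ∞} : ContDiff ℝ m (ev p) := by
  induction p using MvPolynomial.induction_on with
  | C a =>
    have : ev (MvPolynomial.C a : MvPolynomial (Fin n) ℝ) = fun _ => a := by
      ext y; simp [ev]
    rw [this]
    exact contDiff_const
  | add p q hp hq =>
    have : ev (p + q) = fun y => ev p y + ev q y := by
      ext y; simp [ev]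
    rw [this]
    exact hp.add hq
  | mul_X p j hp =>
    have : ev (p * MvPolynomial.X j) = fun y => ev p y * (EuclideanSpace.proj j : EuclideanSpace ℝ (Fin n) →L[ℝ] ℝ) y := by
      ext y; simp [ev]
    rw [this]
    exact hp.mul (ContinuousLinearMap.contDiff _)

lemma ev_smul {n : ℕ} {p : MvPolynomial (Fin n) ℝ} {k : ℕ} (hp : p.IsHomogeneous k) (r : ℝ)
    (x : EuclideanSpace ℝ (Fin n)) : ev p (r • x) = r ^ k * ev p x := by
  unfold ev
  have h2 : (fun i => (r • x) i) = fun i => r * x i := by ext i; simp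
  rw [h2, MvPolynomial.eval_eq, MvPolynomial.eval_eq, Finset.mul_sum]
  apply Finset.sum_congr rfl
  intro d hd
  have hk : ∑ i ∈ d.support, d i = k := by
    have := hp (MvPolynomial.mem_support_iff.mp hd)
    rw [Finsupp.weight_apply] at this
    simpa [Finsupp.sum] using this
  simp_rw [mul_pow, Finset.prod_mul_distrib, Finset.prod_pow_eq_pow_sum, hk]
  ring

lemma lognorm_hasFDerivAt {n : ℕ} {x : EuclideanSpace ℝ (Fin n)} (hx : x ≠ 0) :
    HasFDerivAt (fun y : EuclideanSpace ℝ (Fin n) => Real.log ‖y‖) ((‖x‖ ^ 2)⁻¹ • innerSL ℝ x) x := by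
  have h1 := (hasStrictFDerivAt_norm_sq x).hasFDerivAt
  have hne : ‖x‖ ^ 2 ≠ 0 := by simpa using hx
  have h2 := h1.log hne
  have h3 := h2.const_mul (1/2 : ℝ)
  refine (h3.congr_of_eventuallyEq (Eventually.of_forall fun y => ?_)).congr_fderiv ?_
  · simp
  · ext v; simp; ring

lemma lap_congr {n : ℕ} {u v : EuclideanSpace ℝ (Fin n) → ℝ} {x : EuclideanSpace ℝ (Fin n)}
    (h : u =ᶠ[nhds x] v) : lap u x = lap v x := by
  unfold lap
  rw [(Filter.EventuallyEq.iteratedFDeriv ℝ h 2).eq_of_nhds]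

lemma lap_eq_of {n : ℕ} {u : EuclideanSpace ℝ (Fin n) → ℝ} {x : EuclideanSpace ℝ (Fin n)}
    (hu : ContDiffAt ℝ 2 u x) :
    lap u x = ∑ i, fderiv ℝ (fun y => fderiv ℝ u y (EuclideanSpace.single i 1)) x
      (EuclideanSpace.single i 1) := by
  unfold lap
  apply Finset.sum_congr rfl
  intro i _
  rw [iteratedFDeriv_two_apply]
  have hd : DifferentiableAt ℝ (fderiv ℝ u) x :=
    (hu.fderiv_right (m := 1) (by norm_num)).differentiableAt (by norm_num)
  rw [fderiv_clm_apply hd (by fun_prop)]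
  simp

lemma lap_log_mul {n : ℕ} {F F' F'' : ℝ → ℝ} (hF : ContDiff ℝ 2 F)
    (h1 : ∀ t, HasDerivAt F (F' t) t) (h2 : ∀ t, HasDerivAt F' (F'' t) t)
    {p : MvPolynomial (Fin n) ℝ} {k : ℕ} (hp : p.IsHomogeneous k) (hlap : plap p = 0)
    {x : EuclideanSpace ℝ (Fin n)} (hx : x ≠ 0) :
    lap (fun y => F (Real.log ‖y‖) * ev p y) x =
      (‖x‖ ^ 2)⁻¹ * (F'' (Real.log ‖x‖) + ((n : ℝ) - 2 + 2 * k) * F' (Real.log ‖x‖)) * ev p x := by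
  have hcd : ContDiffAt ℝ 2 (fun y => F (Real.log ‖y‖) * ev p y) x := by
    refine ContDiffAt.mul ?_ (ev_contDiff p).contDiffAt
    exact hF.contDiffAt.comp x ((contDiffAt_norm ℝ hx).log (by simpa using hx))
  rw [lap_eq_of hcd]
  have hfirst : ∀ i, (fun y => fderiv ℝ (fun y => F (Real.log ‖y‖) * ev p y) y (EuclideanSpace.single i 1))
      =ᶠ[nhds x] fun y => F' (Real.log ‖y‖) * ((‖y‖ ^ 2)⁻¹ * (y i * ev p y)) +
        F (Real.log ‖y‖) * ev (MvPolynomial.pderiv i p) y := by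
    intro i
    filter_upwards [isOpen_ne.mem_nhds hx] with y hy
    have := ((h1 _).comp_hasFDerivAt y (lognorm_hasFDerivAt hy)).mul (ev_hasFDerivAt p y)
    have e := this.fderiv
    simp only [Function.comp_def] at e
    erw [e]
    simp [EuclideanSpace.inner_single_right, PiLp.single_apply]
    ring
  have hsec : ∀ i, fderiv ℝ (fun y => F' (Real.log ‖y‖) * ((‖y‖ ^ 2)⁻¹ * (y i * ev p y)) +
        F (Real.log ‖y‖) * ev (MvPolynomial.pderiv i p) y) x (EuclideanSpace.single i 1) =
      F'' (Real.log ‖x‖) * (‖x‖ ^ 2)⁻¹ * (‖x‖ ^ 2)⁻¹ * ev p x * (x i) ^ 2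
      + F' (Real.log ‖x‖) * (‖x‖ ^ 2)⁻¹ * ev p x
      - 2 * F' (Real.log ‖x‖) * (‖x‖ ^ 2)⁻¹ * (‖x‖ ^ 2)⁻¹ * ev p x * (x i) ^ 2
      + 2 * F' (Real.log ‖x‖) * (‖x‖ ^ 2)⁻¹ * (x i * ev (MvPolynomial.pderiv i p) x)
      + F (Real.log ‖x‖) * ev (MvPolynomial.pderiv i (MvPolynomial.pderiv i p)) x := by
    intro i
    have hne : ‖x‖ ^ 2 ≠ 0 := by simpa using hx
    have hinv := (hasDerivAt_inv hne).comp_hasFDerivAt x (hasStrictFDerivAt_norm_sq x).hasFDerivAt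
    have hpr := (EuclideanSpace.proj i : EuclideanSpace ℝ (Fin n) →L[ℝ] ℝ).hasFDerivAt (x := x)
    have hA := ((h2 _).comp_hasFDerivAt x (lognorm_hasFDerivAt hx)).mul
      (hinv.mul (hpr.mul (ev_hasFDerivAt p x)))
    have hB := ((h1 _).comp_hasFDerivAt x (lognorm_hasFDerivAt hx)).mul
      (ev_hasFDerivAt (MvPolynomial.pderiv i p) x)
    have e := (hA.add hB).fderiv
    simp only [Function.comp_def] at e
    erw [e]
    simp [EuclideanSpace.inner_single_right, PiLp.single_apply]
    ring
  have e1 : ∑ i, (x i) ^ 2 = ‖x‖ ^ 2 := by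
    rw [EuclideanSpace.norm_sq_eq]; simp
  have e2 : ∑ i, x i * ev (MvPolynomial.pderiv i p) x = k * ev p x := by
    have := congrArg (fun q => ev q x) hp.sum_X_mul_pderiv
    simpa [ev] using this
  have e3 : ∑ i, ev (MvPolynomial.pderiv i (MvPolynomial.pderiv i p)) x = 0 := by
    rw [plap_apply] at hlap
    have := congrArg (fun q => ev q x) hlap
    simpa [ev] using this
  rw [Finset.sum_congr rfl fun i _ => by rw [(hfirst i).fderiv_eq, hsec i]]
  simp only [Finset.sum_add_distrib, Finset.sum_sub_distrib, ← Finset.mul_sum, e1, e2, e3]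
  have hne : ‖x‖ ^ 2 ≠ 0 := by simpa using hx
  simp
  field_simp
  ring

lemma lap_exp_log {n : ℕ} {F F' F'' : ℝ → ℝ} (c : ℝ) (hF : ContDiff ℝ 2 F)
    (h1 : ∀ t, HasDerivAt F (F' t) t) (h2 : ∀ t, HasDerivAt F' (F'' t) t)
    {p : MvPolynomial (Fin n) ℝ} {k : ℕ} (hp : p.IsHomogeneous k) (hlap : plap p = 0)
    {x : EuclideanSpace ℝ (Fin n)} (hx : x ≠ 0) :
    lap (fun y => (Real.exp (c * Real.log ‖y‖) * F (Real.log ‖y‖)) * ev p y) x =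
      (‖x‖ ^ 2)⁻¹ * (Real.exp (c * Real.log ‖x‖) * (F'' (Real.log ‖x‖)
        + (2 * c + ((n : ℝ) - 2 + 2 * k)) * F' (Real.log ‖x‖)
        + c * (c + ((n : ℝ) - 2 + 2 * k)) * F (Real.log ‖x‖))) * ev p x := by
  have he : ∀ t : ℝ, HasDerivAt (fun t => Real.exp (c * t)) (Real.exp (c * t) * c) t := by
    intro t
    have := ((hasDerivAt_id t).const_mul c).exp
    simpa using this
  have := lap_log_mul (n := n) (F := fun t => Real.exp (c * t) * F t)
    (F' := fun t => Real.exp (c * t) * c * F t + Real.exp (c * t) * F' t)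
    (F'' := fun t => (Real.exp (c * t) * c * c * F t + Real.exp (c * t) * c * F' t) +
      (Real.exp (c * t) * c * F' t + Real.exp (c * t) * F'' t))
    (by fun_prop) (fun t => (he t).mul (h1 t))
    (fun t => (((he t).mul_const c).mul (h1 t)).add ((he t).mul (h2 t))) hp hlap hx
  rw [this]
  ring

lemma lap_eq_zero_of_notMem {n : ℕ} {u : EuclideanSpace ℝ (Fin n) → ℝ}
    {x : EuclideanSpace ℝ (Fin n)} (hx : x ∉ tsupport u) : lap u x = 0 := by
  have h : u =ᶠ[nhds x] fun _ => 0 := notMem_tsupport_iff_eventuallyEq.mp hx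
  rw [lap_congr h, lap_eq_of contDiffAt_const]
  simp

lemma lap_continuous {n : ℕ} {u : EuclideanSpace ℝ (Fin n) → ℝ} (hu : ContDiff ℝ 2 u) :
    Continuous (lap u) := by
  unfold lap
  have := hu.continuous_iteratedFDeriv (m := 2) le_rfl
  fun_prop

/-- Continuity of a product of a compactly supported function in the punctured space with one
continuous away from the origin. -/
lemma cont_mul {n : ℕ} {f g : EuclideanSpace ℝ (Fin n) → ℝ} (hf : Continuous f)
    (hs : tsupport f ⊆ {0}ᶜ) (hg : ContinuousOn g {0}ᶜ) : Continuous fun x => f x * g x := by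
  rw [continuous_iff_continuousAt]
  intro x
  by_cases hx : x = 0
  · have h : f =ᶠ[nhds x] fun _ => 0 :=
      notMem_tsupport_iff_eventuallyEq.mp fun h => hs h (by simpa using hx)
    have : (fun x => f x * g x) =ᶠ[nhds x] fun _ => 0 := by
      filter_upwards [h] with y hy
      simp [hy]
    exact continuousAt_const.congr this.symm
  · exact hf.continuousAt.mul (hg.continuousAt (isOpen_compl_singleton.mem_nhds hx))

lemma integrable_mul' {n : ℕ} {f g : EuclideanSpace ℝ (Fin n) → ℝ} (hf : Continuous f)
    (hc : HasCompactSupport f)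
    (hs : tsupport f ⊆ {0}ᶜ) (hg : ContinuousOn g {0}ᶜ) : Integrable fun x => f x * g x :=
  (cont_mul hf hs hg).integrable_of_hasCompactSupport hc.mul_right

lemma tsupport_pd {n : ℕ} (u : EuclideanSpace ℝ (Fin n) → ℝ) (e : EuclideanSpace ℝ (Fin n)) :
    tsupport (fun y => fderiv ℝ u y e) ⊆ tsupport u := by
  refine closure_minimal (fun x hx => ?_) (isClosed_tsupport u)
  by_contra h
  apply hx
  have h : u =ᶠ[nhds x] fun _ => 0 := notMem_tsupport_iff_eventuallyEq.mp h
  simp [h.fderiv_eq]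

lemma green {n : ℕ} {u v : EuclideanSpace ℝ (Fin n) → ℝ} (hu : ContDiff ℝ 2 u)
    (hc : HasCompactSupport u) (hs : tsupport u ⊆ {0}ᶜ) (hv : ContDiffOn ℝ 2 v {0}ᶜ) :
    ∫ x, lap u x * v x = ∫ x, u x * lap v x := by
  have hop : IsOpen ({0}ᶜ : Set (EuclideanSpace ℝ (Fin n))) := isOpen_compl_singleton
  let e : Fin n → EuclideanSpace ℝ (Fin n) := fun i => EuclideanSpace.single i 1
  let u1 : Fin n → EuclideanSpace ℝ (Fin n) → ℝ := fun i y => fderiv ℝ u y (e i)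
  let u2 : Fin n → EuclideanSpace ℝ (Fin n) → ℝ := fun i y => fderiv ℝ (u1 i) y (e i)
  let v1 : Fin n → EuclideanSpace ℝ (Fin n) → ℝ := fun i y => fderiv ℝ v y (e i)
  let v2 : Fin n → EuclideanSpace ℝ (Fin n) → ℝ := fun i y => fderiv ℝ (v1 i) y (e i)
  have hu1 : ∀ i, ContDiff ℝ 1 (u1 i) := fun i =>
    (hu.fderiv_right (m := 1) (by norm_num)).clm_apply contDiff_const
  have hu2 : ∀ i, Continuous (u2 i) := fun i =>
    ((hu1 i).continuous_fderiv (by norm_num)).clm_apply continuous_const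
  have hv1 : ∀ i, ContDiffOn ℝ 1 (v1 i) {0}ᶜ := fun i =>
    (hv.fderiv_of_isOpen hop (m := 1) (by norm_num)).clm_apply contDiffOn_const
  have hv2 : ∀ i, ContinuousOn (v2 i) {0}ᶜ := fun i =>
    ((hv1 i).continuousOn_fderiv_of_isOpen hop (by norm_num)).clm_apply continuousOn_const
  have su1 : ∀ i, tsupport (u1 i) ⊆ tsupport u := fun i => tsupport_pd u _
  have su2 : ∀ i, tsupport (u2 i) ⊆ tsupport u := fun i => (tsupport_pd _ _).trans (su1 i)
  have cu1 : ∀ i, HasCompactSupport (u1 i) := fun i =>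
    hc.of_isClosed_subset (isClosed_tsupport _) (su1 i)
  have cu2 : ∀ i, HasCompactSupport (u2 i) := fun i =>
    hc.of_isClosed_subset (isClosed_tsupport _) (su2 i)
  have hdv : ∀ x ∈ tsupport u, DifferentiableAt ℝ v x := fun x hx =>
    (hv.contDiffAt (hop.mem_nhds (hs hx))).differentiableAt (by norm_num)
  have hdv1 : ∀ i, ∀ x ∈ tsupport u, DifferentiableAt ℝ (v1 i) x := fun i x hx =>
    ((hv1 i).contDiffAt (hop.mem_nhds (hs hx))).differentiableAt (by norm_num)
  have key : ∀ i, ∫ x, u2 i x * v x = ∫ x, u x * v2 i x := by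
    intro i
    have s1 := integral_bilinear_hasLineDerivAt_right_eq_neg_left_of_integrable
      (μ := (volume : Measure (EuclideanSpace ℝ (Fin n)))) (f := u) (f' := u1 i) (g := v1 i) (g' := v2 i)
      (v := e i) (B := ContinuousLinearMap.mul ℝ ℝ)
      (integrable_mul' (hu1 i).continuous (cu1 i) ((su1 i).trans hs) (hv1 i).continuousOn)
      (integrable_mul' hu.continuous hc hs (hv2 i))
      (integrable_mul' hu.continuous hc hs (hv1 i).continuousOn)
      (fun x _ => ((hu.differentiable (by norm_num)) x).hasFDerivAt.hasLineDerivAt _)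
      (fun x hx => (hdv1 i x hx).hasFDerivAt.hasLineDerivAt _)
    have s2 := integral_bilinear_hasLineDerivAt_right_eq_neg_left_of_integrable
      (μ := (volume : Measure (EuclideanSpace ℝ (Fin n)))) (f := u1 i) (f' := u2 i) (g := v) (g' := v1 i)
      (v := e i) (B := ContinuousLinearMap.mul ℝ ℝ)
      (integrable_mul' (hu2 i) (cu2 i) ((su2 i).trans hs) hv.continuousOn)
      (integrable_mul' (hu1 i).continuous (cu1 i) ((su1 i).trans hs) (hv1 i).continuousOn)
      (integrable_mul' (hu1 i).continuous (cu1 i) ((su1 i).trans hs) hv.continuousOn)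
      (fun x _ => (((hu1 i).differentiable (by norm_num)) x).hasFDerivAt.hasLineDerivAt _)
      (fun x hx => (hdv x (su1 i hx)).hasFDerivAt.hasLineDerivAt _)
    simp only [ContinuousLinearMap.mul_apply'] at s1 s2
    linarith
  have el : ∀ x, lap u x * v x = ∑ i, u2 i x * v x := by
    intro x
    rw [lap_eq_of hu.contDiffAt, Finset.sum_mul]
  have er : ∀ x, u x * lap v x = ∑ i, u x * v2 i x := by
    intro x
    by_cases hx : u x = 0
    · simp [hx]
    · have : x ∈ tsupport u := subset_tsupport u hx
      rw [lap_eq_of (hv.contDiffAt (hop.mem_nhds (hs this))), Finset.mul_sum]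
  simp_rw [el, er]
  rw [integral_finsetSum, integral_finsetSum]
  · exact Finset.sum_congr rfl fun i _ => key i
  · exact fun i _ => integrable_mul' hu.continuous hc hs (hv2 i)
  · exact fun i _ => integrable_mul' (hu2 i) (cu2 i) ((su2 i).trans hs) hv.continuousOn

/-- the polynomial `|x|²` -/
noncomputable def rsq (n : ℕ) : MvPolynomial (Fin n) ℝ := ∑ i, MvPolynomial.X i ^ 2

lemma rsq_hom (n : ℕ) : (rsq n).IsHomogeneous 2 :=
  MvPolynomial.IsHomogeneous.sum _ _ _ fun i _ => by
    simpa using (MvPolynomial.isHomogeneous_X ℝ i).pow 2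

lemma pderiv_rsq {n : ℕ} (i : Fin n) :
    MvPolynomial.pderiv i (rsq n) = 2 * MvPolynomial.X i := by
  simp [rsq, MvPolynomial.pderiv_X, Pi.single_apply, Derivation.leibniz_pow]

lemma plap_hom {n d : ℕ} {p : MvPolynomial (Fin n) ℝ} (hp : p.IsHomogeneous d) :
    (plap p).IsHomogeneous (d - 2) := by
  rw [plap_apply]
  exact MvPolynomial.IsHomogeneous.sum _ _ _ fun i _ => by
    have := (hp.pderiv (i := i)).pderiv (i := i)
    simpa [Nat.sub_sub] using this

lemma plap_eq_zero_of_lt {n d : ℕ} {p : MvPolynomial (Fin n) ℝ} (hp : p.IsHomogeneous d)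
    (hd : d < 2) : plap p = 0 := by
  rw [plap_apply]
  apply Finset.sum_eq_zero
  intro i _
  have h := hp.pderiv (i := i)
  have : d - 1 = 0 := by omega
  rw [this] at h
  have h2 := MvPolynomial.totalDegree_eq_zero_iff_eq_C.mp (Nat.le_zero.mp h.totalDegree_le)
  rw [h2]; simp

lemma plap_iter_eq_zero {n : ℕ} (i : ℕ) : ∀ {d : ℕ} {p : MvPolynomial (Fin n) ℝ}
    (hp : p.IsHomogeneous d) (hd : d < 2 * i), (plap^[i]) p = 0 := by
  induction i with
  | zero => intro d p hp hd; omega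
  | succ i ih =>
    intro d p hp hd
    rw [Function.iterate_succ_apply]
    by_cases h : d < 2
    · rw [plap_eq_zero_of_lt hp h]
      exact Function.iterate_fixed (map_zero plap) i
    · exact ih (plap_hom hp) (by omega)

lemma plap_iter_hom {n : ℕ} (i : ℕ) : ∀ {d : ℕ} {p : MvPolynomial (Fin n) ℝ}
    (hp : p.IsHomogeneous d), ((plap^[i]) p).IsHomogeneous (d - 2 * i) := by
  induction i with
  | zero => intro d p hp; simpa using hp
  | succ i ih =>
    intro d p hp
    rw [Function.iterate_succ_apply]
    have := ih (plap_hom hp)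
    convert this using 1
    omega

lemma plap_rsq_mul {n d : ℕ} {p : MvPolynomial (Fin n) ℝ} (hp : p.IsHomogeneous d) :
    plap (rsq n * p) = rsq n * plap p + (2 * (n : ℝ) + 4 * d) • p := by
  have e := hp.sum_X_mul_pderiv
  have : ∀ i : Fin n, MvPolynomial.pderiv i (MvPolynomial.pderiv i (rsq n * p)) =
      rsq n * MvPolynomial.pderiv i (MvPolynomial.pderiv i p) +
      4 * (MvPolynomial.X i * MvPolynomial.pderiv i p) + 2 * p := by
    intro i
    simp only [Derivation.leibniz, map_add, smul_eq_mul, pderiv_rsq, MvPolynomial.pderiv_X_self]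
    have h2 : MvPolynomial.pderiv i (2 : MvPolynomial (Fin n) ℝ) = 0 := by
      have : (2 : MvPolynomial (Fin n) ℝ) = MvPolynomial.C 2 := (map_ofNat MvPolynomial.C 2).symm
      rw [this]; exact MvPolynomial.pderiv_C
    rw [h2]
    ring
  rw [plap_apply, plap_apply]
  simp_rw [this, Finset.sum_add_distrib, ← Finset.mul_sum, e]
  simp only [MvPolynomial.smul_eq_C_mul, nsmul_eq_mul, map_add, map_mul, MvPolynomial.C_eq_coe_nat, map_natCast, map_ofNat, Finset.sum_const, Finset.card_univ, Fintype.card_fin]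
  ring

lemma plap_rsq_pow_mul {n d : ℕ} (hn : 0 < n) {h : MvPolynomial (Fin n) ℝ}
    (hp : h.IsHomogeneous d) (hl : plap h = 0) (i : ℕ) :
    ∃ c : ℝ, 0 < c ∧ plap (rsq n ^ (i + 1) * h) = c • (rsq n ^ i * h) := by
  have hn' : (0 : ℝ) < n := by exact_mod_cast hn
  induction i with
  | zero =>
    refine ⟨2 * (n : ℝ) + 4 * d, by positivity, ?_⟩
    simp [plap_rsq_mul hp, hl]
  | succ i ih =>
    obtain ⟨c, hc, e⟩ := ih
    have hom : (rsq n ^ (i + 1) * h).IsHomogeneous (2 * (i + 1) + d) := ((rsq_hom n).pow _).mul hp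
    refine ⟨c + (2 * (n : ℝ) + 4 * ((2 * (i + 1) + d : ℕ) : ℝ)), by positivity, ?_⟩
    rw [pow_succ', mul_assoc, plap_rsq_mul hom, e, add_smul c, mul_smul_comm, ← mul_assoc, ← pow_succ']

lemma plap_iter_rsq {n d : ℕ} (hn : 0 < n) {h : MvPolynomial (Fin n) ℝ}
    (hp : h.IsHomogeneous d) (hl : plap h = 0) (i : ℕ) :
    ∃ c : ℝ, 0 < c ∧ (plap^[i]) (rsq n ^ i * h) = c • h := by
  induction i with
  | zero => exact ⟨1, one_pos, by simp⟩
  | succ i ih =>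
    obtain ⟨c, hc, e⟩ := ih
    obtain ⟨c', hc', e'⟩ := plap_rsq_pow_mul hn hp hl i
    refine ⟨c' * c, by positivity, ?_⟩
    rw [Function.iterate_succ_apply, e', ← Module.End.pow_apply, map_smul, Module.End.pow_apply, e,
      smul_smul]

lemma decomp_aux {n : ℕ} (hn : 0 < n) (j : ℕ) : ∀ {d : ℕ} {p : MvPolynomial (Fin n) ℝ}
    (hp : p.IsHomogeneous d) (hd : (plap^[j]) p = 0),
    p ∈ Submodule.span ℝ {q | ∃ (i k : ℕ) (h : MvPolynomial (Fin n) ℝ), h.IsHomogeneous k ∧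
      plap h = 0 ∧ q = rsq n ^ i * h} := by
  induction j with
  | zero => intro d p hp hd; simp at hd; simp [hd]
  | succ j ih =>
    intro d p hp hd
    by_cases hlt : d < 2 * j
    · exact ih hp (plap_iter_eq_zero j hp hlt)
    set h := (plap^[j]) p with hh
    have hl : plap h = 0 := by rw [hh, ← Function.iterate_succ_apply' plap]; exact hd
    have hom : h.IsHomogeneous (d - 2 * j) := plap_iter_hom j hp
    obtain ⟨c, hc, e⟩ := plap_iter_rsq hn hom hl j
    have hom' : (rsq n ^ j * h).IsHomogeneous d := by
      have := ((rsq_hom n).pow j).mul hom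
      convert this using 1
      omega
    have h1 := ih (d := d) (p := p - c⁻¹ • (rsq n ^ j * h)) (hp.sub (by
      rw [MvPolynomial.smul_eq_C_mul]
      simpa using (MvPolynomial.isHomogeneous_C (Fin n) c⁻¹).mul hom')) (by
      rw [← Module.End.pow_apply, map_sub, map_smul, Module.End.pow_apply, Module.End.pow_apply,
        e, smul_smul, inv_mul_cancel₀ hc.ne', one_smul, sub_self])
    have h2 := Submodule.add_mem _ h1 (Submodule.smul_mem _ c⁻¹ (Submodule.subset_span
      ⟨j, d - 2 * j, h, hom, hl, rfl⟩))
    simpa using h2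

lemma decomp {n : ℕ} (hn : 0 < n) (p : MvPolynomial (Fin n) ℝ) :
    p ∈ Submodule.span ℝ {q | ∃ (i k : ℕ) (h : MvPolynomial (Fin n) ℝ), h.IsHomogeneous k ∧
      plap h = 0 ∧ q = rsq n ^ i * h} := by
  rw [← MvPolynomial.sum_homogeneousComponent p]
  refine Submodule.sum_mem _ fun d _ => ?_
  have := MvPolynomial.homogeneousComponent_isHomogeneous d p
  exact decomp_aux hn (d + 1) this (plap_iter_eq_zero (d + 1) this (by omega))

lemma ev_rsq {n : ℕ} (x : EuclideanSpace ℝ (Fin n)) : ev (rsq n) x = ‖x‖ ^ 2 := by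
  rw [EuclideanSpace.norm_sq_eq]; simp [ev, rsq]

lemma pd_comm {n : ℕ} (i j : Fin n) (p : MvPolynomial (Fin n) ℝ) :
    MvPolynomial.pderiv i (MvPolynomial.pderiv j p) = MvPolynomial.pderiv j (MvPolynomial.pderiv i p) := by
  have : ⁅(MvPolynomial.pderiv i : Derivation ℝ (MvPolynomial (Fin n) ℝ) (MvPolynomial (Fin n) ℝ)),
      (MvPolynomial.pderiv j : Derivation ℝ (MvPolynomial (Fin n) ℝ) (MvPolynomial (Fin n) ℝ))⁆ = 0 := by
    apply MvPolynomial.derivation_ext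
    intro k
    rw [Derivation.commutator_apply]
    have : ∀ l m : Fin n, MvPolynomial.pderiv l (MvPolynomial.pderiv m (MvPolynomial.X k : MvPolynomial (Fin n) ℝ)) = 0 := by
      intro l m
      rw [MvPolynomial.pderiv_X, Pi.single_apply]
      split_ifs <;> simp
    rw [this, this]; simp
  have h := congrArg (fun D => D p) this
  simpa [Derivation.commutator_apply, sub_eq_zero] using h

lemma exists_harmonic {n : ℕ} (i0 i1 : Fin n) (h01 : i0 ≠ i1) (k : ℕ) :
    ∃ p : MvPolynomial (Fin n) ℝ, p.IsHomogeneous k ∧ plap p = 0 ∧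
      ev p (EuclideanSpace.single i0 1) = 1 := by
  have key : ∃ a b : MvPolynomial (Fin n) ℝ, a.IsHomogeneous k ∧ b.IsHomogeneous k ∧
      MvPolynomial.pderiv i0 a = MvPolynomial.pderiv i1 b ∧
      MvPolynomial.pderiv i1 a = - MvPolynomial.pderiv i0 b ∧
      (∀ i, i ≠ i0 → i ≠ i1 → MvPolynomial.pderiv i a = 0 ∧ MvPolynomial.pderiv i b = 0) ∧
      ev a (EuclideanSpace.single i0 1) = 1 := by
    induction k with
    | zero =>
      refine ⟨1, 0, MvPolynomial.isHomogeneous_one _ _, MvPolynomial.isHomogeneous_zero _ _ _, ?_⟩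
      simp [ev]
    | succ k ih =>
      obtain ⟨a, b, ha, hb, e1, e2, e3, e4⟩ := ih
      have X0 := MvPolynomial.isHomogeneous_X ℝ i0
      have X1 := MvPolynomial.isHomogeneous_X ℝ i1
      refine ⟨a * MvPolynomial.X i0 - b * MvPolynomial.X i1, b * MvPolynomial.X i0 + a * MvPolynomial.X i1,
        (ha.mul X0).sub (hb.mul X1), (hb.mul X0).add (ha.mul X1), ?_, ?_, ?_, ?_⟩
      · simp [Derivation.leibniz, MvPolynomial.pderiv_X, Pi.single_apply, h01, h01.symm, e1, e2]
        ring
      · simp [Derivation.leibniz, MvPolynomial.pderiv_X, Pi.single_apply, h01, h01.symm, e1, e2]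
        ring
      · intro i h0 h1
        obtain ⟨e5, e6⟩ := e3 i h0 h1
        simp [Derivation.leibniz, MvPolynomial.pderiv_X, Pi.single_apply, h0, h1, h0.symm, h1.symm, e5, e6]
      · simp [ev, h01.symm] at e4 ⊢
        exact e4
  obtain ⟨a, b, ha, hb, e1, e2, e3, e4⟩ := key
  refine ⟨a, ha, ?_, e4⟩
  rw [plap_apply, ← Finset.add_sum_erase _ _ (Finset.mem_univ i0),
    ← Finset.add_sum_erase (Finset.univ.erase i0) _ (by simp [h01.symm] : i1 ∈ Finset.univ.erase i0)]
  rw [Finset.sum_eq_zero, e1, e2, pd_comm i0 i1]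
  · simp
  · intro i hi
    simp at hi
    rw [(e3 i hi.2 hi.1).1, map_zero]

/-- the exponential as a map to the positive half line -/
noncomputable def expIoi (t : ℝ) : Ioi (0 : ℝ) := ⟨Real.exp t, Real.exp_pos t⟩

lemma expIoi_meas : MeasurableEmbedding expIoi := by
  have : Measurable expIoi := Real.measurable_exp.subtype_mk
  refine this.measurableEmbedding fun a b h => ?_
  exact Real.exp_injective (congrArg Subtype.val h)

lemma expIoi_mp (n : ℕ) (hn : 0 < n) :
    MeasurePreserving expIoi (volume.withDensity fun t : ℝ => ENNReal.ofReal (Real.exp (n * t)))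
      (Measure.volumeIoiPow (n - 1)) := by
  refine ⟨expIoi_meas.measurable, ?_⟩
  ext s hs
  rw [Measure.map_apply expIoi_meas.measurable hs,
    withDensity_apply _ (expIoi_meas.measurable hs), Measure.volumeIoiPow, withDensity_apply _ hs,
    setLIntegral_subtype measurableSet_Ioi _ fun a : ℝ ↦ .ofReal (a ^ (n - 1))]
  have him : Subtype.val '' s = Real.exp '' (expIoi ⁻¹' s) := by
    ext y
    constructor
    · rintro ⟨z, hz, rfl⟩
      refine ⟨Real.log z.1, ?_, Real.exp_log z.2⟩
      have : expIoi (Real.log z.1) = z := Subtype.ext (Real.exp_log z.2)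
      simpa [this] using hz
    · rintro ⟨t, ht, rfl⟩
      exact ⟨expIoi t, ht, rfl⟩
  rw [him, lintegral_image_eq_lintegral_abs_deriv_mul (expIoi_meas.measurable hs)
    (fun x _ => (Real.hasDerivAt_exp x).hasDerivWithinAt) Real.exp_injective.injOn]
  refine lintegral_congr fun t => ?_
  rw [← ENNReal.ofReal_mul (abs_nonneg _), abs_of_pos (Real.exp_pos t), ← pow_succ',
    Nat.sub_add_cancel hn, ← Real.exp_nat_mul]

lemma polar {n : ℕ} (hn : 0 < n) {V : Type*} [NormedAddCommGroup V] [NormedSpace ℝ V]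
    (f : EuclideanSpace ℝ (Fin n) → V) :
    ∫ x, f x = ∫ p : sphere (0 : EuclideanSpace ℝ (Fin n)) 1 × ℝ,
      Real.exp (n * p.2) • f (Real.exp p.2 • (p.1 : EuclideanSpace ℝ (Fin n)))
      ∂((volume : Measure (EuclideanSpace ℝ (Fin n))).toSphere.prod volume) := by
  haveI : Nonempty (Fin n) := ⟨⟨0, hn⟩⟩
  have s1 : ∫ x, f x = ∫ x : ({(0)}ᶜ : Set (EuclideanSpace ℝ (Fin n))), f x.1
      ∂((volume : Measure (EuclideanSpace ℝ (Fin n))).comap Subtype.val) := by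
    rw [integral_subtype_comap (measurableSet_singleton _).compl f, restrict_compl_singleton]
  have s2 := (volume : Measure (EuclideanSpace ℝ (Fin n))).measurePreserving_homeomorphUnitSphereProd.integral_comp
        (Homeomorph.measurableEmbedding _) (fun q => f ((homeomorphUnitSphereProd _).symm q).1)
  simp only [Homeomorph.symm_apply_apply, finrank_euclideanSpace, Fintype.card_fin] at s2
  have mp := (MeasurePreserving.id (volume : Measure (EuclideanSpace ℝ (Fin n))).toSphere).prod
    (expIoi_mp n hn)
  have s3 := mp.integral_comp (MeasurableEmbedding.id.prodMap expIoi_meas)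
    (fun q => f ((homeomorphUnitSphereProd _).symm q).1)
  rw [s1, s2, ← s3, prod_withDensity_right (by fun_prop)]
  simp only [ENNReal.ofReal]
  rw [integral_withDensity_eq_integral_smul (by fun_prop)]
  refine integral_congr_ae (Eventually.of_forall fun p => ?_)
  simp only [NNReal.smul_def, Real.coe_toNNReal _ (Real.exp_pos _).le, Prod.map, id]
  rfl

lemma polar_mul {n : ℕ} (hn : 0 < n) (f : EuclideanSpace ℝ (Fin n) → ℝ) (F : ℝ → ℝ)
    (g : EuclideanSpace ℝ (Fin n) → ℝ)
    (h : ∀ t σ, ‖σ‖ = 1 → Real.exp (n * t) * f (Real.exp t • σ) = F t * g σ) :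
    ∫ x, f x = (∫ t, F t) * ∫ σ : sphere (0 : EuclideanSpace ℝ (Fin n)) 1, g σ
      ∂(volume : Measure (EuclideanSpace ℝ (Fin n))).toSphere := by
  rw [polar hn, mul_comm, ← integral_prod_mul]
  refine integral_congr_ae (Eventually.of_forall fun p => ?_)
  simp only [smul_eq_mul]
  rw [h _ _ (by simpa using p.1.2), mul_comm]

/-- radial-power times profile times polynomial -/
noncomputable def mode {n : ℕ} (c : ℝ) (F : ℝ → ℝ) (p : MvPolynomial (Fin n) ℝ) :
    EuclideanSpace ℝ (Fin n) → ℝ :=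
  fun y => (Real.exp (c * Real.log ‖y‖) * F (Real.log ‖y‖)) * ev p y

lemma mode_contDiffOn {n : ℕ} (c : ℝ) {F : ℝ → ℝ} (hF : ContDiff ℝ 2 F)
    (p : MvPolynomial (Fin n) ℝ) : ContDiffOn ℝ 2 (mode c F p) {0}ᶜ := by
  intro x hx
  have hx : x ≠ 0 := hx
  have h1 : ContDiffAt ℝ 2 (fun y : EuclideanSpace ℝ (Fin n) => Real.log ‖y‖) x :=
    (contDiffAt_norm ℝ hx).log (by simpa using hx)
  have h2 : ContDiffAt ℝ 2 (fun y : EuclideanSpace ℝ (Fin n) => F (Real.log ‖y‖)) x :=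
    hF.contDiffAt.comp x h1
  exact (((contDiffAt_const.mul h1).exp.mul h2).mul (ev_contDiff p).contDiffAt).contDiffWithinAt

lemma mode_polar {n : ℕ} (c : ℝ) (F : ℝ → ℝ) {p : MvPolynomial (Fin n) ℝ} {k : ℕ}
    (hp : p.IsHomogeneous k) (t : ℝ) {σ : EuclideanSpace ℝ (Fin n)} (hσ : ‖σ‖ = 1) :
    mode c F p (Real.exp t • σ) = Real.exp ((c + k) * t) * F t * ev p σ := by
  unfold mode
  rw [norm_smul, hσ, mul_one, Real.norm_of_nonneg (Real.exp_pos t).le, Real.log_exp, ev_smul hp,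
    ← Real.exp_nat_mul, add_mul, Real.exp_add]
  ring

lemma lap_mode {n : ℕ} {F F' F'' : ℝ → ℝ} (c : ℝ) (hF : ContDiff ℝ 2 F)
    (h1 : ∀ t, HasDerivAt F (F' t) t) (h2 : ∀ t, HasDerivAt F' (F'' t) t)
    {p : MvPolynomial (Fin n) ℝ} {k : ℕ} (hp : p.IsHomogeneous k) (hlap : plap p = 0)
    {x : EuclideanSpace ℝ (Fin n)} (hx : x ≠ 0) :
    lap (mode c F p) x = mode (c - 2) (fun t => F'' t + (2 * c + ((n : ℝ) - 2 + 2 * k)) * F' t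
      + c * (c + ((n : ℝ) - 2 + 2 * k)) * F t) p x := by
  have h := lap_exp_log c hF h1 h2 hp hlap hx
  unfold mode
  rw [h]
  have hpos : 0 < ‖x‖ := norm_pos_iff.mpr hx
  have : Real.exp ((c - 2) * Real.log ‖x‖) = (‖x‖ ^ 2)⁻¹ * Real.exp (c * Real.log ‖x‖) := by
    rw [sub_mul, Real.exp_sub, div_eq_inv_mul]
    congr 2
    rw [two_mul, Real.exp_add, Real.exp_log hpos, sq]
  rw [this]
  ring

/-- bounded away from zero support criterion -/
lemma adm_of {n : ℕ} {u : EuclideanSpace ℝ (Fin n) → ℝ} (hu : ContDiffOn ℝ 2 u {0}ᶜ) {R : ℝ}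
    (h0 : u 0 = 0)
    (hR : ∀ x, x ≠ 0 → u x ≠ 0 → |Real.log ‖x‖| ≤ R) :
    DirichletAdm {(0 : EuclideanSpace ℝ (Fin n))}ᶜ u := by
  have hsub : Function.support u ⊆ {x | Real.exp (-R) ≤ ‖x‖} ∩ closedBall 0 (Real.exp R) := by
    intro x hx
    have hx0 : x ≠ 0 := by rintro rfl; exact hx h0
    have hpos : 0 < ‖x‖ := norm_pos_iff.mpr hx0
    have := abs_le.mp (hR x hx0 hx)
    refine ⟨?_, ?_⟩
    · exact (Real.le_log_iff_exp_le hpos).mp this.1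
    · rw [mem_closedBall_zero_iff]
      exact (Real.log_le_iff_le_exp hpos).mp this.2
  have hcl : IsClosed ({x : EuclideanSpace ℝ (Fin n) | Real.exp (-R) ≤ ‖x‖}) :=
    isClosed_le continuous_const continuous_norm
  have hts : tsupport u ⊆ {x | Real.exp (-R) ≤ ‖x‖} ∩ closedBall 0 (Real.exp R) :=
    closure_minimal hsub (hcl.inter isClosed_closedBall)
  have hts0 : tsupport u ⊆ {0}ᶜ := by
    intro x hx h
    have h1 : Real.exp (-R) ≤ ‖x‖ := (hts hx).1
    rw [mem_singleton_iff.mp h, norm_zero] at h1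
    exact absurd h1 (not_le.mpr (Real.exp_pos _))
  refine ⟨?_, ?_, hts0⟩
  · rw [contDiff_iff_contDiffAt]
    intro x
    by_cases hx : x = 0
    · have h : u =ᶠ[nhds x] fun _ => 0 :=
        notMem_tsupport_iff_eventuallyEq.mp fun h => hts0 h (by simpa using hx)
      exact contDiffAt_const.congr_of_eventuallyEq h
    · exact hu.contDiffAt (isOpen_compl_singleton.mem_nhds hx)
  · exact (isCompact_closedBall 0 (Real.exp R)).of_isClosed_subset (isClosed_tsupport u)
      (hts.trans inter_subset_right)

lemma mode_adm {n : ℕ} (c : ℝ) {F : ℝ → ℝ} (hF : ContDiff ℝ 2 F) {R : ℝ}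
    (hR : ∀ t, F t ≠ 0 → |t| ≤ R) (h0 : F 0 = 0)
    (p : MvPolynomial (Fin n) ℝ) : DirichletAdm {(0 : EuclideanSpace ℝ (Fin n))}ᶜ (mode c F p) := by
  refine adm_of (mode_contDiffOn c hF p) (R := R) ?_ ?_
  · simp [mode, h0]
  · intro x _ hx
    refine hR _ fun h => hx ?_
    simp [mode, h]

/-- Existence of a nice one-dimensional profile vanishing at `0`. -/
lemma exists_profile : ∃ F F' F'' : ℝ → ℝ, ContDiff ℝ 2 F ∧ (∀ t, HasDerivAt F (F' t) t) ∧
    (∀ t, HasDerivAt F' (F'' t) t) ∧ Continuous F'' ∧ (∀ t, F t ≠ 0 → |t| ≤ 3) ∧ F 0 = 0 ∧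
    (∀ t, 0 ≤ F t) ∧ F 2 = 1 := by
  let b : ContDiffBump (2 : ℝ) := ⟨1/2, 1, by norm_num, by norm_num⟩
  have hb : ContDiff ℝ 3 (b : ℝ → ℝ) := b.contDiff
  refine ⟨b, deriv b, deriv (deriv b), b.contDiff, ?_, ?_, ?_, ?_, ?_, ?_, ?_⟩
  · intro t
    exact (hb.differentiable (by norm_num)).differentiableAt.hasDerivAt
  · intro t
    have : ContDiff ℝ 2 (deriv b) := hb.deriv'
    exact (this.differentiable (by norm_num)).differentiableAt.hasDerivAt
  · have : ContDiff ℝ 2 (deriv b) := hb.deriv'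
    have : ContDiff ℝ 1 (deriv (deriv b)) := this.deriv'
    exact this.continuous
  · intro t ht
    have : t ∈ Function.support b := ht
    rw [b.support_eq] at this
    rw [Real.ball_eq_Ioo] at this
    have h1 := this.1
    have h2 := this.2
    simp only [b] at h1 h2
    rw [abs_le]; constructor <;> linarith
  · apply b.zero_of_le_dist
    simp [b]
  · intro t; exact b.nonneg
  · exact b.one_of_mem_closedBall (by simp [b])

lemma hasDerivAt_zero_of_out {F F' : ℝ → ℝ} (h1 : ∀ t, HasDerivAt F (F' t) t) {R : ℝ}
    (hR : ∀ t, F t ≠ 0 → |t| ≤ R) : ∀ t, F' t ≠ 0 → |t| ≤ R := by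
  intro t ht
  by_contra h
  push Not at h
  have : F =ᶠ[nhds t] fun _ => 0 := by
    have : {s : ℝ | R < |s|} ∈ nhds t := (isOpen_lt continuous_const continuous_abs).mem_nhds h
    filter_upwards [this] with s hs
    by_contra h'
    exact absurd (hR s h') (not_le.mpr hs)
  exact ht ((h1 t).unique ((hasDerivAt_const t (0:ℝ)).congr_of_eventuallyEq this))

lemma cs_of_out {F : ℝ → ℝ} {R : ℝ} (hR : ∀ t, F t ≠ 0 → |t| ≤ R) : HasCompactSupport F := by
  refine HasCompactSupport.of_support_subset_isCompact (isCompact_Icc (a := -R) (b := R)) ?_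
  intro t ht
  exact abs_le.mp (hR t ht)

lemma sphere_orth {n : ℕ} (hn : 2 ≤ n) {p q : MvPolynomial (Fin n) ℝ} {k l : ℕ}
    (hp : p.IsHomogeneous k) (hq : q.IsHomogeneous l) (hpl : plap p = 0) (hql : plap q = 0)
    (hkl : k ≠ l) :
    ∫ σ : sphere (0 : EuclideanSpace ℝ (Fin n)) 1, ev p σ * ev q σ
      ∂(volume : Measure (EuclideanSpace ℝ (Fin n))).toSphere = 0 := by
  obtain ⟨F, F', F'', hF, h1, h2, hc2, hR, h0, hnn, hF2⟩ := exists_profile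
  have hn' : (2 : ℝ) ≤ n := by exact_mod_cast hn
  set I := ∫ σ : sphere (0 : EuclideanSpace ℝ (Fin n)) 1, ev p σ * ev q σ
      ∂(volume : Measure (EuclideanSpace ℝ (Fin n))).toSphere
  set c : ℝ := -(((n : ℝ) - 2) / 2 + k) with hcdef
  set d : ℝ := -(((n : ℝ) - 2) / 2 + l) with hddef
  obtain ⟨hu, hcs, hs⟩ := mode_adm c hF hR h0 p
  have hv : ContDiffOn ℝ 2 (mode d (fun _ => 1) q) {0}ᶜ := mode_contDiffOn d contDiff_const q
  have hg := green hu hcs hs hv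
  have hR' := hasDerivAt_zero_of_out h1 hR
  have hR'' := hasDerivAt_zero_of_out h2 hR'
  have hFc : Continuous F := hF.continuous
  have hF'c : Continuous F' := continuous_iff_continuousAt.mpr fun t => (h2 t).continuousAt
  have iF : Integrable F := hFc.integrable_of_hasCompactSupport (cs_of_out hR)
  have iF' : Integrable F' := hF'c.integrable_of_hasCompactSupport (cs_of_out hR')
  have iF'' : Integrable F'' := hc2.integrable_of_hasCompactSupport (cs_of_out hR'')
  have e1 : ∫ x, lap (mode c F p) x * mode d (fun _ => 1) q x
      = (∫ t, (F'' t - c ^ 2 * F t)) * I := by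
    refine polar_mul (by omega) _ _ (fun σ => ev p σ * ev q σ) fun t σ hσ => ?_
    have hne : Real.exp t • σ ≠ 0 := by
      intro h
      have := congrArg norm h
      simp [norm_smul, hσ] at this
    rw [lap_mode c hF h1 h2 hp hpl hne, mode_polar _ _ hp t hσ, mode_polar _ _ hq t hσ]
    have : Real.exp (n * t) * (Real.exp ((c - 2 + k) * t) * Real.exp ((d + l) * t)) = 1 := by
      rw [← Real.exp_add, ← Real.exp_add, ← Real.exp_zero]
      congr 1
      rw [hcdef, hddef]; ring
    have hN : 2 * c + ((n : ℝ) - 2 + 2 * k) = 0 := by rw [hcdef]; ring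
    have hN2 : c * (c + ((n : ℝ) - 2 + 2 * k)) = - c ^ 2 := by rw [hcdef]; ring
    rw [hN, hN2]
    linear_combination ((F'' t - c ^ 2 * F t) * (ev p σ * ev q σ)) * this
  have e2 : ∫ x, mode c F p x * lap (mode d (fun _ => 1) q) x
      = (∫ t, (- d ^ 2 * F t)) * I := by
    refine polar_mul (by omega) _ _ (fun σ => ev p σ * ev q σ) fun t σ hσ => ?_
    have hne : Real.exp t • σ ≠ 0 := by
      intro h
      have := congrArg norm h
      simp [norm_smul, hσ] at this
    rw [lap_mode (F' := fun _ => 0) (F'' := fun _ => 0) d contDiff_const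
      (fun t => hasDerivAt_const _ _) (fun t => hasDerivAt_const _ _) hq hql hne,
      mode_polar _ _ hp t hσ, mode_polar _ _ hq t hσ]
    have : Real.exp (n * t) * (Real.exp ((c + k) * t) * Real.exp ((d - 2 + l) * t)) = 1 := by
      rw [← Real.exp_add, ← Real.exp_add, ← Real.exp_zero]
      congr 1
      rw [hcdef, hddef]; ring
    have hN2 : d * (d + ((n : ℝ) - 2 + 2 * l)) = - d ^ 2 := by rw [hddef]; ring
    rw [hN2]
    linear_combination ((- d ^ 2 * F t) * (ev p σ * ev q σ)) * this
  rw [e1, e2, integral_sub iF'' (iF.const_mul _), integral_const_mul, integral_const_mul,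
    integral_eq_zero_of_hasDerivAt_of_integrable h2 iF'' iF'] at hg
  have hpos : 0 < ∫ t, F t := by
    refine hFc.integral_pos_of_hasCompactSupport_nonneg_nonzero (cs_of_out hR) hnn (x := 2) ?_
    rw [hF2]; norm_num
  have hcd : d ^ 2 - c ^ 2 ≠ 0 := by
    have h3 : (l : ℝ) - k ≠ 0 := by
      rw [sub_ne_zero]; exact_mod_cast hkl.symm
    have h4 : (0 : ℝ) < (n : ℝ) - 2 + (k + l) := by
      have : 0 < k + l := by omega
      have : (0 : ℝ) < k + l := by exact_mod_cast this
      linarith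
    have : d ^ 2 - c ^ 2 = (l - k) * ((n : ℝ) - 2 + (k + l)) := by rw [hcdef, hddef]; ring
    rw [this]
    exact mul_ne_zero h3 h4.ne'
  have : (d ^ 2 - c ^ 2) * (∫ t, F t) * I = 0 := by linear_combination hg
  rcases mul_eq_zero.mp this with h | h
  · rcases mul_eq_zero.mp h with h | h
    · exact absurd h hcd
    · exact absurd h hpos.ne'
  · exact h

lemma exp_smul_ne {n : ℕ} (t : ℝ) {σ : EuclideanSpace ℝ (Fin n)} (hσ : ‖σ‖ = 1) :
    Real.exp t • σ ≠ 0 := by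
  intro h
  have := congrArg norm h
  simp [norm_smul, hσ] at this

lemma norm_exp_smul_rpow {n : ℕ} (t a : ℝ) {σ : EuclideanSpace ℝ (Fin n)} (hσ : ‖σ‖ = 1) :
    ‖Real.exp t • σ‖ ^ a = Real.exp (a * t) := by
  rw [norm_smul, hσ, mul_one, Real.norm_of_nonneg (Real.exp_pos t).le, ← Real.exp_mul, mul_comm]

/-- the ratio set is bounded below -/
lemma ratio_nonneg {n : ℕ} {α q : ℝ} (h : q ∈ RellichRatioSet n α) : 0 ≤ q := by
  obtain ⟨u, -, -, rfl⟩ := h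
  refine div_nonneg (integral_nonneg fun x => ?_) (integral_nonneg fun x => ?_) <;>
  exact mul_nonneg (Real.rpow_nonneg (norm_nonneg _) _) (sq_nonneg _)

lemma ratio_mem {n : ℕ} (hn : 2 ≤ n) (α : ℝ) (k : ℕ) {F F' F'' : ℝ → ℝ} (hF : ContDiff ℝ 2 F)
    (h1 : ∀ t, HasDerivAt F (F' t) t) (h2 : ∀ t, HasDerivAt F' (F'' t) t)
    {R : ℝ} (hR : ∀ t, F t ≠ 0 → |t| ≤ R) (h0 : F 0 = 0) (hne : ∃ t, F t ≠ 0) :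
    (∫ t, (F'' t + (2 - α) * F' t - (gam n α + (k : ℝ) * ((n : ℝ) - 2 + (k : ℝ))) * F t) ^ 2) /
      (∫ t, F t ^ 2) ∈ RellichRatioSet n α := by
  obtain ⟨p, hp, hpl, hp1⟩ := exists_harmonic (n := n) ⟨0, by omega⟩ ⟨1, by omega⟩ (by simp) k
  set c : ℝ := -((α + n - 4) / 2) - k with hc
  have hsn : ‖(EuclideanSpace.single (⟨0, by omega⟩ : Fin n) (1:ℝ))‖ = 1 := by simp
  have hJ : 0 < ∫ σ : sphere (0 : EuclideanSpace ℝ (Fin n)) 1, ev p σ ^ 2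
      ∂(volume : Measure (EuclideanSpace ℝ (Fin n))).toSphere := by
    have hcont : Continuous fun σ : sphere (0 : EuclideanSpace ℝ (Fin n)) 1 => ev p σ ^ 2 :=
      ((ev_contDiff p (m := 0)).continuous.comp continuous_subtype_val).pow 2
    refine hcont.integral_pos_of_hasCompactSupport_nonneg_nonzero
      (HasCompactSupport.of_compactSpace _) (fun σ => sq_nonneg _)
      (x := ⟨EuclideanSpace.single ⟨0, by omega⟩ 1, by simp⟩) ?_
    simp only [hp1]; norm_num
  refine ⟨mode c F p, mode_adm c hF hR h0 p, ?_, ?_⟩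
  · obtain ⟨t, ht⟩ := hne
    refine ⟨Real.exp t • EuclideanSpace.single ⟨0, by omega⟩ 1, ?_⟩
    rw [mode_polar _ _ hp _ hsn, hp1]
    simp [ht, (Real.exp_pos _).ne']
  · rw [polar_mul (by omega) (fun x => ‖x‖ ^ α * (lap (mode c F p) x) ^ 2)
      (fun t => (F'' t + (2 - α) * F' t - (gam n α + (k : ℝ) * ((n : ℝ) - 2 + (k : ℝ))) * F t) ^ 2)
      (fun σ => ev p σ ^ 2), polar_mul (by omega) (fun x => ‖x‖ ^ (α - 4) * (mode c F p x) ^ 2)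
      (fun t => F t ^ 2)
      (fun σ => ev p σ ^ 2), mul_div_mul_right _ _ hJ.ne']
    · intro t σ hσ
      rw [mode_polar _ _ hp _ hσ, norm_exp_smul_rpow _ _ hσ]
      have : Real.exp (n * t) * (Real.exp ((α - 4) * t) * Real.exp ((c + k) * t) ^ 2) = 1 := by
        rw [sq, ← Real.exp_add, ← Real.exp_add, ← Real.exp_add, ← Real.exp_zero]
        congr 1
        rw [hc]; ring
      linear_combination (F t ^ 2 * ev p σ ^ 2) * this
    · intro t σ hσ
      rw [lap_mode c hF h1 h2 hp hpl (exp_smul_ne t hσ), mode_polar _ _ hp _ hσ,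
        norm_exp_smul_rpow _ _ hσ]
      have : Real.exp (n * t) * (Real.exp (α * t) * Real.exp ((c - 2 + k) * t) ^ 2) = 1 := by
        rw [sq, ← Real.exp_add, ← Real.exp_add, ← Real.exp_add, ← Real.exp_zero]
        congr 1
        rw [hc]; ring
      have hN : 2 * c + ((n : ℝ) - 2 + 2 * k) = 2 - α := by rw [hc]; ring
      have hN2 : c * (c + ((n : ℝ) - 2 + 2 * k)) =
        - (gam n α + (k : ℝ) * ((n : ℝ) - 2 + (k : ℝ))) := by rw [hc, gam]; ring
      rw [hN, hN2]
      linear_combination ((F'' t + (2 - α) * F' t -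
        (gam n α + (k : ℝ) * ((n : ℝ) - 2 + (k : ℝ))) * F t) ^ 2 * ev p σ ^ 2) * this

lemma upper {n : ℕ} (hn : 2 ≤ n) (α : ℝ) (k : ℕ) :
    sInf (RellichRatioSet n α) ≤ (gam n α + (k : ℝ) * ((n : ℝ) - 2 + (k : ℝ))) ^ 2 := by
  obtain ⟨F, F', F'', hF, h1, h2, hc2, hR, h0, hnn, hF2⟩ := exists_profile
  set m := gam n α + (k : ℝ) * ((n : ℝ) - 2 + (k : ℝ))
  have hR' := hasDerivAt_zero_of_out h1 hR
  have hR'' := hasDerivAt_zero_of_out h2 hR'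
  have hFc : Continuous F := hF.continuous
  have hF'c : Continuous F' := continuous_iff_continuousAt.mpr fun t => (h2 t).continuousAt
  have hpos : 0 < ∫ t, F t ^ 2 := by
    refine (hFc.pow 2).integral_pos_of_hasCompactSupport_nonneg_nonzero (x := 2)
      ?_ (fun t => sq_nonneg _) (by simp [hF2])
    refine cs_of_out (R := 3) fun t ht => hR t fun h => ht (by simp [h])
  let g : ℝ → ℝ → ℝ := fun ε s => (ε ^ 2 * F'' s + (2 - α) * (ε * F' s) - m * F s) ^ 2
  have hgc : Continuous fun ε => ∫ s, g ε s := by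
    rw [← continuousOn_univ]
    refine continuousOn_integral_of_compact_support (isCompact_Icc (a := (-3:ℝ)) (b := 3)) ?_ ?_
    · apply Continuous.continuousOn
      simp only [g, Function.uncurry_def]
      fun_prop
    · intro ε s _ hs
      have hs' : ¬ |s| ≤ 3 := fun h => hs (abs_le.mp h)
      have a1 : F s = 0 := by by_contra h; exact hs' (hR s h)
      have a2 : F' s = 0 := by by_contra h; exact hs' (hR' s h)
      have a3 : F'' s = 0 := by by_contra h; exact hs' (hR'' s h)
      simp [g, a1, a2, a3]
  have hmem : ∀ ε : ℝ, 0 < ε → (∫ s, g ε s) / (∫ t, F t ^ 2) ∈ RellichRatioSet n α := by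
    intro ε hε
    have := ratio_mem hn α k (F := fun t => F (ε * t)) (F' := fun t => ε * F' (ε * t))
      (F'' := fun t => ε ^ 2 * F'' (ε * t)) (R := 3 / ε) (hF.comp (contDiff_const.mul contDiff_id))
      ?_ ?_ ?_ (by simpa using h0) ⟨2 / ε, ?_⟩
    · have e1 := Measure.integral_comp_mul_left (g ε) ε
      have e2 := Measure.integral_comp_mul_left (fun s => F s ^ 2) ε
      rw [e2] at this
      simp only [g] at e1
      rw [e1] at this
      rw [smul_eq_mul, smul_eq_mul, mul_div_mul_left] at this
      · exact this
      · positivity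
    · intro t
      have := (h1 (ε * t)).comp t ((hasDerivAt_id t).const_mul ε)
      refine this.congr_deriv ?_
      simp [mul_comm]
    · intro t
      have := ((h2 (ε * t)).comp t ((hasDerivAt_id t).const_mul ε)).const_mul ε
      refine this.congr_deriv ?_
      simp; ring
    · intro t ht
      have := hR _ ht
      rw [abs_mul, abs_of_pos hε] at this
      rw [le_div_iff₀ hε]; linarith
    · have : ε * (2 / ε) = 2 := by field_simp
      simp only [this, hF2]; norm_num
  have hlim : Tendsto (fun ε => (∫ s, g ε s) / (∫ t, F t ^ 2)) (nhdsWithin 0 (Ioi 0))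
      (nhds (m ^ 2)) := by
    have h3 : Continuous fun ε => (∫ s, g ε s) / (∫ t, F t ^ 2) := hgc.div_const _
    have h4 := h3.tendsto 0
    have h5 : (∫ s, g 0 s) / (∫ t, F t ^ 2) = m ^ 2 := by
      simp only [g]
      have : (fun s => ((0:ℝ) ^ 2 * F'' s + (2 - α) * (0 * F' s) - m * F s) ^ 2) =
        fun s => m ^ 2 * F s ^ 2 := by ext s; ring
      rw [this, integral_const_mul]
      field_simp
    rw [h5] at h4
    exact h4.mono_left nhdsWithin_le_nhds
  refine ge_of_tendsto hlim ?_
  filter_upwards [self_mem_nhdsWithin] with ε hε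
  exact csInf_le ⟨0, fun q hq => ratio_nonneg hq⟩ (hmem ε hε)

lemma ratio_nonempty {n : ℕ} (hn : 2 ≤ n) (α : ℝ) : (RellichRatioSet n α).Nonempty := by
  obtain ⟨F, F', F'', hF, h1, h2, hc2, hR, h0, hnn, hF2⟩ := exists_profile
  exact ⟨_, ratio_mem hn α 0 hF h1 h2 hR h0 ⟨2, by simp [hF2]⟩⟩

/-- abstract spectral comparison lemma -/
lemma hilb {H ι : Type*} [NormedAddCommGroup H] [InnerProductSpace ℂ H] (A : ι → Set H)
    (hA : ∀ i j, i ≠ j → ∀ a ∈ A i, ∀ b ∈ A j, inner ℂ a b = 0) (U V : H) (s : ι → ℂ) {c : ℝ}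
    (hc : 0 < c) (hs : ∀ i, c ≤ ‖s i‖) (hUV : ∀ i, ∀ a ∈ A i, inner ℂ a V = s i * inner ℂ a U)
    (hU : U ∈ closure (Submodule.span ℂ (⋃ i, A i) : Set H)) : c * ‖U‖ ≤ ‖V‖ := by
  have hs0 : ∀ i, s i ≠ 0 := fun i h => by
    have := hs i; rw [h, norm_zero] at this; linarith
  have horth : ∀ i j, i ≠ j → ∀ a ∈ Submodule.span ℂ (A i), ∀ b ∈ Submodule.span ℂ (A j),
      inner ℂ a b = 0 := by
    intro i j hij
    exact Submodule.isOrtho_iff_inner_eq.mp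
      (Submodule.isOrtho_span.mpr fun a ha b hb => hA i j hij a ha b hb)
  have hrel : ∀ i, ∀ a ∈ Submodule.span ℂ (A i), inner ℂ a V = s i * inner ℂ a U := by
    intro i a ha
    induction ha using Submodule.span_induction with
    | mem x hx => exact hUV i x hx
    | zero => simp
    | add x y _ _ hx hy => rw [inner_add_left, inner_add_left, hx, hy]; ring
    | smul r x _ hx => rw [inner_smul_left, inner_smul_left, hx]; ring
  have nsq : ∀ z : H, inner ℂ z z = (‖z‖ : ℂ) ^ 2 := fun z => inner_self_eq_norm_sq_to_K z
  have key : ∀ p ∈ (Submodule.span ℂ (⋃ i, A i) : Set H), c * ‖inner ℂ p U‖ ≤ ‖p‖ * ‖V‖ := by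
    intro p hp
    rw [SetLike.mem_coe, Submodule.span_iUnion, Submodule.mem_iSup_iff_exists_finsupp] at hp
    obtain ⟨f, hf, rfl⟩ := hp
    set q : H := ∑ i ∈ f.support, (starRingEnd ℂ (s i))⁻¹ • f i with hq
    have e1 : inner ℂ q V = inner ℂ (f.sum fun _ x => x) U := by
      rw [hq, Finsupp.sum, sum_inner, sum_inner]
      refine Finset.sum_congr rfl fun i _ => ?_
      rw [inner_smul_left, hrel i _ (hf i), map_inv₀, Complex.conj_conj, ← mul_assoc,
        inv_mul_cancel₀ (hs0 i), one_mul]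
    have pyth : ∀ r : ι → ℂ, ‖∑ i ∈ f.support, r i • f i‖ ^ 2 =
        ∑ i ∈ f.support, ‖r i‖ ^ 2 * ‖f i‖ ^ 2 := by
      intro r
      rw [← Complex.ofReal_inj]
      push_cast
      rw [← nsq, sum_inner]
      refine Finset.sum_congr rfl fun i hi => ?_
      rw [inner_sum, Finset.sum_eq_single i]
      · rw [nsq, norm_smul]; push_cast; ring
      · intro j _ hji
        rw [inner_smul_left, inner_smul_right, horth i j hji.symm _ (hf i) _ (hf j)]; simp
      · intro h; exact absurd hi h
    have e2 : c * ‖q‖ ≤ ‖f.sum fun _ x => x‖ := by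
      refine le_of_sq_le_sq ?_ (norm_nonneg _)
      have h1 := pyth fun _ => 1
      simp only [one_smul, norm_one, one_pow, one_mul] at h1
      rw [mul_pow, hq, pyth, Finsupp.sum, h1, Finset.mul_sum]
      refine Finset.sum_le_sum fun i _ => ?_
      rw [← mul_assoc]
      refine mul_le_of_le_one_left (sq_nonneg _) ?_
      rw [norm_inv, RCLike.norm_conj, ← mul_pow, ← div_eq_mul_inv]
      have hp : 0 < ‖s i‖ := hc.trans_le (hs i)
      exact pow_le_one₀ (by positivity) ((div_le_one hp).mpr (hs i))
    rw [← e1]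
    calc c * ‖inner ℂ q V‖ ≤ c * (‖q‖ * ‖V‖) := by gcongr; exact norm_inner_le_norm q V
      _ = (c * ‖q‖) * ‖V‖ := by ring
      _ ≤ _ := by gcongr
  have hcl : IsClosed {p : H | c * ‖inner ℂ p U‖ ≤ ‖p‖ * ‖V‖} := by
    refine isClosed_le ?_ ?_ <;> fun_prop
  have h2 : c * ‖inner ℂ U U‖ ≤ ‖U‖ * ‖V‖ := closure_minimal key hcl hU
  rw [nsq, norm_pow, Complex.norm_real, norm_norm] at h2
  rcases (norm_nonneg U).eq_or_lt with h | h
  · rw [← h, mul_zero]; exact norm_nonneg V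
  · nlinarith

/-- Fourier mode times polynomial on the sphere -/
noncomputable def bf {n : ℕ} (T : ℝ) (m : ℤ) (p : MvPolynomial (Fin n) ℝ) :
    C(sphere (0 : EuclideanSpace ℝ (Fin n)) 1 × AddCircle T, ℂ) where
  toFun x := fourier m x.2 * ((ev p x.1 : ℝ) : ℂ)
  continuous_toFun := by
    have := (ev_contDiff p (m := 0)).continuous
    fun_prop

/-- The generating sets -/
def gens (n : ℕ) (T : ℝ) (i : ℤ × ℕ) :
    Set C(sphere (0 : EuclideanSpace ℝ (Fin n)) 1 × AddCircle T, ℂ) :=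
  {f | ∃ h : MvPolynomial (Fin n) ℝ, h.IsHomogeneous i.2 ∧ plap h = 0 ∧ f = bf T i.1 h}

lemma bf_mem {n : ℕ} (hn : 0 < n) (T : ℝ) (m : ℤ) (p : MvPolynomial (Fin n) ℝ) :
    bf T m p ∈ Submodule.span ℂ (⋃ i, gens n T i) := by
  have := decomp hn p
  induction this using Submodule.span_induction with
  | mem x hx =>
    obtain ⟨i, k, h, hk, hl, rfl⟩ := hx
    refine Submodule.subset_span (mem_iUnion.mpr ⟨(m, k), h, hk, hl, ?_⟩)
    ext x
    have : ev (rsq n ^ i * h) x.1 = ev h x.1 := by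
      have h1 : ev (rsq n ^ i * h) x.1 = ev (rsq n) x.1 ^ i * ev h x.1 := by simp [ev]
      rw [h1, ev_rsq]; simp
    simp [bf, this]
  | zero =>
    have : bf T m (0 : MvPolynomial (Fin n) ℝ) = 0 := by ext x; simp [bf, ev]
    rw [this]; exact Submodule.zero_mem _
  | add x y _ _ hx hy =>
    have : bf T m (x + y) = bf T m x + bf T m y := by ext z; simp [bf, ev]; ring
    rw [this]; exact Submodule.add_mem _ hx hy
  | smul r x _ hx =>
    have : bf T m (r • x) = (r : ℂ) • bf T m x := by ext z; simp [bf, ev]; ring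
    rw [this]; exact Submodule.smul_mem _ _ hx

lemma dense_gen {X : Type*} [TopologicalSpace X] [CompactSpace X]
    (D : Submonoid C(X, ℂ)) (hstar : ∀ f ∈ D, star f ∈ D)
    (hsep : ∀ x y : X, x ≠ y → ∃ f ∈ D, f x ≠ f y) (f : C(X, ℂ)) :
    f ∈ closure (Submodule.span ℂ (D : Set C(X, ℂ)) : Set C(X, ℂ)) := by
  have hD : Subalgebra.toSubmodule (Algebra.adjoin ℂ (D : Set C(X, ℂ))) =
      Submodule.span ℂ (D : Set C(X, ℂ)) := by
    rw [Algebra.adjoin_eq_span, Submonoid.closure_eq]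
  let 𝒜 : StarSubalgebra ℂ C(X, ℂ) :=
    { Algebra.adjoin ℂ (D : Set C(X, ℂ)) with
      star_mem' := by
        intro a ha
        change a ∈ Algebra.adjoin ℂ (D : Set C(X, ℂ)) at ha
        change star a ∈ Algebra.adjoin ℂ (D : Set C(X, ℂ))
        induction ha using Algebra.adjoin_induction with
        | mem x hx => exact Algebra.subset_adjoin (hstar x hx)
        | algebraMap r =>
          rw [← algebraMap_star_comm]; exact Subalgebra.algebraMap_mem _ _
        | add x y _ _ hx hy => rw [star_add]; exact Subalgebra.add_mem _ hx hy
        | mul x y _ _ hx hy => rw [star_mul]; exact Subalgebra.mul_mem _ hy hx }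
  have hs : 𝒜.SeparatesPoints := by
    intro x y hxy
    obtain ⟨g, hg, h⟩ := hsep x y hxy
    exact ⟨g, ⟨g, Algebra.subset_adjoin hg, rfl⟩, h⟩
  have htop := ContinuousMap.starSubalgebra_topologicalClosure_eq_top_of_separatesPoints 𝒜 hs
  have hf : f ∈ 𝒜.topologicalClosure := by rw [htop]; trivial
  have hf' : f ∈ closure (𝒜 : Set C(X, ℂ)) := hf
  refine closure_mono (fun g hg => ?_) hf'
  have : g ∈ Subalgebra.toSubmodule (Algebra.adjoin ℂ (D : Set C(X, ℂ))) := hg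
  rwa [hD] at this

lemma bf_mul {n : ℕ} (T : ℝ) (m m' : ℤ) (p q : MvPolynomial (Fin n) ℝ) :
    bf T m p * bf T m' q = bf T (m + m') (p * q) := by
  ext x
  simp only [bf, ContinuousMap.mul_apply, ContinuousMap.coe_mk, fourier_add, ev, map_mul,
    Complex.ofReal_mul]
  ring

/-- the submonoid of elementary functions -/
noncomputable def bfMon (n : ℕ) (T : ℝ) :
    Submonoid C(sphere (0 : EuclideanSpace ℝ (Fin n)) 1 × AddCircle T, ℂ) where
  carrier := {f | ∃ m p, f = bf T m p}
  one_mem' := ⟨0, 1, by ext x; simp [bf, ev]⟩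
  mul_mem' := by
    rintro _ _ ⟨m, p, rfl⟩ ⟨m', q, rfl⟩
    exact ⟨m + m', p * q, bf_mul T m m' p q⟩

lemma gens_dense {n : ℕ} (hn : 0 < n) (T : ℝ) [hT : Fact (0 < T)]
    (f : C(sphere (0 : EuclideanSpace ℝ (Fin n)) 1 × AddCircle T, ℂ)) :
    f ∈ closure (Submodule.span ℂ (⋃ i, gens n T i) :
      Set C(sphere (0 : EuclideanSpace ℝ (Fin n)) 1 × AddCircle T, ℂ)) := by
  have h1 := dense_gen (bfMon n T) ?_ ?_ f
  · refine closure_mono ?_ h1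
    have : Submodule.span ℂ (bfMon n T : Set _) ≤ Submodule.span ℂ (⋃ i, gens n T i) := by
      rw [Submodule.span_le]
      rintro _ ⟨m, p, rfl⟩
      exact bf_mem hn T m p
    exact this
  · rintro _ ⟨m, p, rfl⟩
    refine ⟨-m, p, ?_⟩
    ext x
    simp only [bf, ContinuousMap.star_apply, ContinuousMap.coe_mk, fourier_neg]
    simp
  · intro x y hxy
    by_cases h : x.2 = y.2
    · have h1 : (x.1 : EuclideanSpace ℝ (Fin n)) ≠ y.1 := by
        intro h'
        exact hxy (Prod.ext (Subtype.ext h') h)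
      obtain ⟨i, hi⟩ : ∃ i, (x.1 : EuclideanSpace ℝ (Fin n)) i ≠ (y.1 : EuclideanSpace ℝ (Fin n)) i := by
        by_contra h'
        push Not at h'
        exact h1 (by ext i; exact h' i)
      refine ⟨bf T 0 (MvPolynomial.X i), ⟨0, MvPolynomial.X i, rfl⟩, ?_⟩
      simpa [bf, ev] using hi
    · refine ⟨bf T 1 1, ⟨1, 1, rfl⟩, ?_⟩
      have : (AddCircle.toCircle x.2 : ℂ) ≠ AddCircle.toCircle y.2 := fun h' =>
        h (AddCircle.injective_toCircle hT.out.ne' (Circle.ext h'))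
      simpa [bf, ev, fourier_one] using this

/-- measure on sphere times circle -/
noncomputable abbrev mu0 (n : ℕ) (T : ℝ) [hT : Fact (0 < T)] :
    Measure (sphere (0 : EuclideanSpace ℝ (Fin n)) 1 × AddCircle T) :=
  (volume : Measure (EuclideanSpace ℝ (Fin n))).toSphere.prod volume

lemma gens_orth {n : ℕ} (hn : 2 ≤ n) (T : ℝ) [hT : Fact (0 < T)] (i j : ℤ × ℕ) (hij : i ≠ j)
    (f g : C(sphere (0 : EuclideanSpace ℝ (Fin n)) 1 × AddCircle T, ℂ)) (hf : f ∈ gens n T i)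
    (hg : g ∈ gens n T j) : ∫ x, g x * (starRingEnd ℂ) (f x) ∂(mu0 n T) = 0 := by
  obtain ⟨p, hp, hpl, rfl⟩ := hf
  obtain ⟨q, hq, hql, rfl⟩ := hg
  have : ∀ x : sphere (0 : EuclideanSpace ℝ (Fin n)) 1 × AddCircle T,
      bf T j.1 q x * (starRingEnd ℂ) (bf T i.1 p x) =
      (((ev p x.1 * ev q x.1 : ℝ) : ℂ)) * fourier (j.1 - i.1) x.2 := by
    intro x
    simp only [bf, ContinuousMap.coe_mk, map_mul, Complex.conj_ofReal, sub_eq_add_neg, fourier_add,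
      fourier_neg]
    push_cast
    ring
  simp_rw [this]
  rw [integral_prod_mul (fun σ : sphere (0 : EuclideanSpace ℝ (Fin n)) 1 => ((ev p σ * ev q σ : ℝ) : ℂ))
    (fun θ : AddCircle T => fourier (j.1 - i.1) θ)]
  by_cases h : i.2 = j.2
  · have h1 : j.1 - i.1 ≠ 0 := by
      intro h'
      exact hij (Prod.ext (by omega) h)
    rw [integral_eq_zero_of_add_right_eq_neg (fourier_add_half_inv_index h1 hT.out), mul_zero]
  · rw [integral_complex_ofReal, sphere_orth hn hp hq hpl hql h]
    simp

lemma exists_lift {n : ℕ} {L : ℝ} [hL : Fact (0 < 2 * L)]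
    (g : sphere (0 : EuclideanSpace ℝ (Fin n)) 1 × ℝ → ℂ) (hg : Continuous g)
    (hz : ∀ p, L ≤ |p.2| → g p = 0) :
    ∃ G : C(sphere (0 : EuclideanSpace ℝ (Fin n)) 1 × AddCircle (2 * L), ℂ),
      ∀ σ, ∀ t ∈ Icc (-L) L, G (σ, (t : AddCircle (2 * L))) = g (σ, t) := by
  have hL0 : 0 < L := by have := hL.out; linarith
  let g' : C(ℝ, C(sphere (0 : EuclideanSpace ℝ (Fin n)) 1, ℂ)) :=
    ContinuousMap.curry ⟨fun p => g (p.2, p.1), by fun_prop⟩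
  have hg' : ∀ t σ, g' t σ = g (σ, t) := fun t σ => rfl
  have h0 : ∀ t, L ≤ |t| → g' t = 0 := by
    intro t ht
    ext σ
    rw [hg', hz _ ht]; rfl
  have e : -L + 2 * L = L := by ring
  have hper : g' (-L) = g' (-L + 2 * L) := by
    rw [e, h0 _ (by rw [abs_neg, abs_of_pos hL0]), h0 _ (by rw [abs_of_pos hL0])]
  have hlc : Continuous (AddCircle.liftIco (2 * L) (-L) g') :=
    AddCircle.liftIco_continuous hper g'.continuous.continuousOn
  refine ⟨⟨fun x => AddCircle.liftIco (2 * L) (-L) g' x.2 x.1, ?_⟩, ?_⟩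
  · exact (hlc.comp continuous_snd).eval continuous_fst
  · intro σ t ht
    simp only [ContinuousMap.coe_mk]
    rcases ht.2.eq_or_lt with h | h
    · have : (t : AddCircle (2 * L)) = ((-L : ℝ) : AddCircle (2 * L)) := by
        rw [h]
        have := AddCircle.coe_add_period (2 * L) (-L)
        rw [e] at this
        exact this
      rw [this, AddCircle.liftIco_coe_apply (by rw [e]; constructor <;> linarith), hg',
        hz _ (by simp [abs_of_pos hL0]), hz _ (by simp [h, abs_of_pos hL0])]
    · rw [AddCircle.liftIco_coe_apply (by rw [e]; exact ⟨ht.1, h⟩), hg']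

lemma circle_int {n : ℕ} {L : ℝ} [hL : Fact (0 < 2 * L)]
    (Φ : C(sphere (0 : EuclideanSpace ℝ (Fin n)) 1 × AddCircle (2 * L), ℂ))
    (Ψ : sphere (0 : EuclideanSpace ℝ (Fin n)) 1 × ℝ → ℂ)
    (h1 : ∀ σ, ∀ t ∈ Icc (-L) L, Ψ (σ, t) = Φ (σ, (t : AddCircle (2 * L))))
    (h2 : ∀ p, L ≤ |p.2| → Ψ p = 0) :
    ∫ x, Φ x ∂(mu0 n (2 * L)) =
      ∫ p, Ψ p ∂((volume : Measure (EuclideanSpace ℝ (Fin n))).toSphere.prod volume) := by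
  have e : -L + 2 * L = L := by ring
  have mp := (MeasurePreserving.id (volume : Measure (EuclideanSpace ℝ (Fin n))).toSphere).prod
    (AddCircle.measurePreserving_mk (2 * L) (-L))
  rw [e] at mp
  rw [mu0, ← mp.map_eq, integral_map mp.measurable.aemeasurable
    (by exact Φ.continuous.aestronglyMeasurable)]
  have : (volume : Measure (EuclideanSpace ℝ (Fin n))).toSphere.prod
      ((volume : Measure ℝ).restrict (Ioc (-L) L)) =
      ((volume : Measure (EuclideanSpace ℝ (Fin n))).toSphere.prod
      (volume : Measure ℝ)).restrict (univ ×ˢ Ioc (-L) L) := by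
    rw [← Measure.prod_restrict, Measure.restrict_univ]
  rw [this, ← setIntegral_eq_integral_of_forall_compl_eq_zero (s := univ ×ˢ Ioc (-L) L)
    (f := Ψ)]
  · refine setIntegral_congr_fun (MeasurableSet.univ.prod measurableSet_Ioc) ?_
    rintro ⟨σ, t⟩ ⟨-, ht⟩
    exact (h1 σ t ⟨ht.1.le, ht.2⟩).symm
  · rintro ⟨σ, t⟩ ht
    apply h2
    by_contra h
    push Not at h
    exact ht ⟨mem_univ _, (abs_lt.mp h).1, (abs_lt.mp h).2.le⟩

lemma fourier_conj {L : ℝ} [hL : Fact (0 < 2 * L)] (m : ℤ) (t : ℝ) :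
    (starRingEnd ℂ) (fourier m (t : AddCircle (2 * L))) =
      ((Real.cos (Real.pi * m / L * t) : ℝ) : ℂ) - Complex.I * ((Real.sin (Real.pi * m / L * t) : ℝ) : ℂ) := by
  have hL0 : L ≠ 0 := by have := hL.out; intro h; rw [h] at this; simp at this
  rw [fourier_coe_apply]
  have : (2 * (Real.pi : ℂ) * Complex.I * m * t / ((2 * L : ℝ) : ℂ)) =
      ((Real.pi * m / L * t : ℝ) : ℂ) * Complex.I := by
    have : (L : ℂ) ≠ 0 := by exact_mod_cast hL0
    push_cast
    field_simp
  rw [this, Complex.exp_mul_I, ← Complex.ofReal_cos, ← Complex.ofReal_sin]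
  simp only [map_add, map_mul, Complex.conj_ofReal, Complex.conj_I]
  ring

lemma transfer {n : ℕ} (hn : 0 < n) {L : ℝ} [hL : Fact (0 < 2 * L)] (a : ℝ)
    {w : EuclideanSpace ℝ (Fin n) → ℝ} (hw : Continuous w) (hcs : HasCompactSupport w)
    (hs : tsupport w ⊆ {0}ᶜ) (hwL : ∀ x, w x ≠ 0 → |Real.log ‖x‖| < L) :
    ∃ W : C(sphere (0 : EuclideanSpace ℝ (Fin n)) 1 × AddCircle (2 * L), ℂ),
      (∫ x, W x * (starRingEnd ℂ) (W x) ∂(mu0 n (2 * L)) =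
        ((∫ x, ‖x‖ ^ (2 * a - n) * w x ^ 2 : ℝ) : ℂ)) ∧
      ∀ (m : ℤ) (k : ℕ) (h : MvPolynomial (Fin n) ℝ), h.IsHomogeneous k →
        ∫ x, W x * (starRingEnd ℂ) (bf (2 * L) m h x) ∂(mu0 n (2 * L)) =
        ((∫ x, w x * mode (a - n - k) (fun t => Real.cos (Real.pi * m / L * t)) h x : ℝ) : ℂ) -
        Complex.I *
        ((∫ x, w x * mode (a - n - k) (fun t => Real.sin (Real.pi * m / L * t)) h x : ℝ) : ℂ) := by
  let g : sphere (0 : EuclideanSpace ℝ (Fin n)) 1 × ℝ → ℂ := fun p =>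
    ((Real.exp (a * p.2) * w (Real.exp p.2 • (p.1 : EuclideanSpace ℝ (Fin n))) : ℝ) : ℂ)
  have hg : Continuous g := by
    simp only [g]
    have h2 : Continuous fun p : sphere (0 : EuclideanSpace ℝ (Fin n)) 1 × ℝ =>
      w (Real.exp p.2 • (p.1 : EuclideanSpace ℝ (Fin n))) := by fun_prop
    fun_prop
  have hnorm : ∀ σ : sphere (0 : EuclideanSpace ℝ (Fin n)) 1, ‖(σ : EuclideanSpace ℝ (Fin n))‖ = 1 :=
    fun σ => by simp
  have hz : ∀ p, L ≤ |p.2| → g p = 0 := by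
    intro p hp
    have : w (Real.exp p.2 • (p.1 : EuclideanSpace ℝ (Fin n))) = 0 := by
      by_contra h
      have := hwL _ h
      rw [norm_smul, hnorm, mul_one, Real.norm_of_nonneg (Real.exp_pos _).le, Real.log_exp] at this
      linarith
    simp [g, this]
  obtain ⟨W, hW⟩ := exists_lift g hg hz
  refine ⟨W, ?_, ?_⟩
  · have e1 := circle_int (W * star W) (fun p => g p * (starRingEnd ℂ) (g p)) ?_ ?_
    · have e2 : ∫ x, W x * (starRingEnd ℂ) (W x) ∂(mu0 n (2 * L)) =
          ∫ x, (W * star W) x ∂(mu0 n (2 * L)) := rfl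
      rw [e2, e1, ← integral_complex_ofReal, polar hn]
      refine integral_congr_ae (Eventually.of_forall fun p => ?_)
      simp only [g, Complex.conj_ofReal, Complex.real_smul]
      rw [norm_exp_smul_rpow _ _ (hnorm _)]
      norm_cast
      have : Real.exp (n * p.2) * Real.exp ((2 * a - n) * p.2) = Real.exp (a * p.2) ^ 2 := by
        rw [sq, ← Real.exp_add, ← Real.exp_add]; congr 1; ring
      linear_combination (-(w (Real.exp p.2 • (p.1 : EuclideanSpace ℝ (Fin n))) ^ 2)) * this
    · intro σ t ht
      simp [hW σ t ht]
    · intro p hp; simp [hz p hp]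
  · intro m k h hh
    have e1 := circle_int (W * star (bf (2 * L) m h))
      (fun p => g p * (starRingEnd ℂ) (bf (2 * L) m h (p.1, (p.2 : AddCircle (2 * L))))) ?_ ?_
    · have e2 : ∫ x, W x * (starRingEnd ℂ) (bf (2 * L) m h x) ∂(mu0 n (2 * L)) =
          ∫ x, (W * star (bf (2 * L) m h)) x ∂(mu0 n (2 * L)) := rfl
      have i1 : Integrable fun x => w x * mode (a - n - k) (fun t => Real.cos (Real.pi * m / L * t)) h x :=
        integrable_mul' hw hcs hs (mode_contDiffOn _ (by fun_prop) _).continuousOn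
      have i2 : Integrable fun x => w x * mode (a - n - k) (fun t => Real.sin (Real.pi * m / L * t)) h x :=
        integrable_mul' hw hcs hs (mode_contDiffOn _ (by fun_prop) _).continuousOn
      rw [e2, e1, ← integral_complex_ofReal, ← integral_complex_ofReal, ← integral_const_mul,
        ← integral_sub i1.ofReal (i2.ofReal.const_mul _), polar hn]
      refine integral_congr_ae (Eventually.of_forall fun p => ?_)
      simp only [g, bf, ContinuousMap.coe_mk, map_mul, Complex.conj_ofReal, Complex.real_smul]
      rw [fourier_conj, mode_polar _ _ hh _ (hnorm _), mode_polar _ _ hh _ (hnorm _)]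
      have : Real.exp (n * p.2) * Real.exp ((a - n - k + k) * p.2) = Real.exp (a * p.2) := by
        rw [← Real.exp_add]; congr 1; ring
      rw [← this]
      push_cast
      ring
    · intro σ t ht
      simp [hW σ t ht]
    · intro p hp; simp [hz p hp]

lemma green_mode {n : ℕ} (α ω : ℝ) {u : EuclideanSpace ℝ (Fin n) → ℝ}
    (hu : DirichletAdm {(0 : EuclideanSpace ℝ (Fin n))}ᶜ u) {k : ℕ} {h : MvPolynomial (Fin n) ℝ}
    (hh : h.IsHomogeneous k) (hl : plap h = 0) {F F' F'' : ℝ → ℝ} {b d : ℝ} {G : ℝ → ℝ}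
    (hF : ContDiff ℝ 2 F) (hG : ContDiff ℝ 2 G)
    (h1 : ∀ t, HasDerivAt F (F' t) t) (h2 : ∀ t, HasDerivAt F' (F'' t) t)
    (hFG : ∀ t, F'' t + (α - 2) * F' t = b * F t + d * G t) :
    ∫ x, lap u x * mode ((α - n) / 2 - k) F h x =
      (b - (gam n α + (k : ℝ) * ((n : ℝ) - 2 + (k : ℝ)))) *
        (∫ x, u x * mode ((α - n) / 2 - k - 2) F h x) +
      d * (∫ x, u x * mode ((α - n) / 2 - k - 2) G h x) := by
  obtain ⟨hu1, hc, hs⟩ := hu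
  rw [green hu1 hc hs (mode_contDiffOn _ hF _), ← integral_const_mul, ← integral_const_mul,
    ← integral_add]
  · refine integral_congr_ae (Eventually.of_forall fun x => ?_)
    simp only
    by_cases hx : x = 0
    · have : u x = 0 := by
        by_contra h'
        exact hs (subset_tsupport u h') hx
      simp [this]
    · rw [lap_mode _ hF h1 h2 hh hl hx]
      set m := gam n α + (k : ℝ) * ((n : ℝ) - 2 + (k : ℝ)) with hm
      have hN : 2 * ((α - n) / 2 - k) + ((n : ℝ) - 2 + 2 * k) = α - 2 := by ring
      have hN2 : ((α - n) / 2 - k) * ((α - n) / 2 - k + ((n : ℝ) - 2 + 2 * k)) = - m := by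
        rw [hm, gam]; ring
      rw [hN, hN2]
      unfold mode
      have := hFG (Real.log ‖x‖)
      linear_combination (u x * Real.exp (((α - n) / 2 - k - 2) * Real.log ‖x‖) * ev h x) * this
  · exact (integrable_mul' hu1.continuous hc hs (mode_contDiffOn _ hF _).continuousOn).const_mul _
  · exact (integrable_mul' hu1.continuous hc hs (mode_contDiffOn _ hG _).continuousOn).const_mul _

lemma norm_s_bound {n : ℕ} (hn : 2 ≤ n) (α ω : ℝ) (k : ℕ) {c : ℝ}
    (hc : c ≤ |gam n α + (k : ℝ) * ((n : ℝ) - 2 + (k : ℝ))|) :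
    c ≤ ‖(((-ω ^ 2 - (gam n α + (k : ℝ) * ((n : ℝ) - 2 + (k : ℝ))) : ℝ) : ℂ) -
      Complex.I * (((α - 2) * ω : ℝ) : ℂ))‖ := by
  refine hc.trans ?_
  set m := gam n α + (k : ℝ) * ((n : ℝ) - 2 + (k : ℝ)) with hm
  have h0 : 0 ≤ 2 * m + (α - 2) ^ 2 := by
    have hn' : (2 : ℝ) ≤ n := by exact_mod_cast hn
    have hk : (0 : ℝ) ≤ k := Nat.cast_nonneg k
    have h1 : 0 ≤ (k : ℝ) * ((n : ℝ) - 2 + k) := mul_nonneg hk (by linarith)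
    rw [hm, gam]
    nlinarith [sq_nonneg ((n : ℝ) - 2), sq_nonneg (α - 2)]
  refine abs_le_of_sq_le_sq ?_ (norm_nonneg _)
  rw [← Complex.normSq_eq_norm_sq, Complex.normSq_apply]
  simp only [Complex.sub_re, Complex.ofReal_re, Complex.mul_re, Complex.I_re, Complex.I_im,
    Complex.ofReal_im, Complex.sub_im, Complex.mul_im]
  nlinarith [mul_nonneg h0 (sq_nonneg ω), sq_nonneg (ω ^ 2)]

lemma lower {n : ℕ} (hn : 2 ≤ n) (α : ℝ) {c : ℝ} (hc : 0 < c)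
    (hck : ∀ k : ℕ, c ≤ |gam n α + (k : ℝ) * ((n : ℝ) - 2 + (k : ℝ))|)
    {u : EuclideanSpace ℝ (Fin n) → ℝ}
    (hu : DirichletAdm {(0 : EuclideanSpace ℝ (Fin n))}ᶜ u) :
    c ^ 2 * (∫ x, ‖x‖ ^ (α - 4) * (u x) ^ 2) ≤ ∫ x, ‖x‖ ^ α * (lap u x) ^ 2 := by
  have hu' := hu
  obtain ⟨hu1, hcs, hs⟩ := hu
  have hn0 : 0 < n := by omega
  have hlc := lap_continuous hu1
  have hlts : tsupport (lap u) ⊆ tsupport u := by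
    refine closure_minimal (fun x hx => ?_) (isClosed_tsupport u)
    by_contra h
    exact hx (lap_eq_zero_of_notMem h)
  have hlcs : HasCompactSupport (lap u) := hcs.of_isClosed_subset (isClosed_tsupport _) hlts
  obtain ⟨C, hC⟩ := IsCompact.exists_bound_of_continuousOn (f := fun x => Real.log ‖x‖)
    (show IsCompact (tsupport u) from hcs)
    (fun x hx => (continuous_norm.continuousAt.log
      (by simpa using hs hx)).continuousWithinAt)
  set L : ℝ := |C| + 1 with hLdef
  have hLpos : 0 < L := by positivity
  have hL : Fact (0 < 2 * L) := ⟨by positivity⟩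
  have hCL : ∀ x ∈ tsupport u, |Real.log ‖x‖| < L := by
    intro x hx
    have := hC x hx
    rw [Real.norm_eq_abs] at this
    have h2 := le_abs_self C
    rw [hLdef]; linarith
  obtain ⟨U, hUn, hUp⟩ := transfer hn0 (L := L) ((α - 4 + n) / 2) hu1.continuous hcs hs
    (fun x hx => hCL x (subset_tsupport u hx))
  obtain ⟨V, hVn, hVp⟩ := transfer hn0 (L := L) ((α + n) / 2) hlc hlcs (hlts.trans hs)
    (fun x hx => hCL x (hlts (subset_tsupport _ hx)))
  let Λ := ContinuousMap.toLp (E := ℂ) 2 (mu0 n (2 * L)) ℂ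
  have hin : ∀ f g, inner ℂ (Λ f) (Λ g) = ∫ x, g x * (starRingEnd ℂ) (f x) ∂(mu0 n (2 * L)) :=
    fun f g => ContinuousMap.inner_toLp _ f g
  have key := hilb (fun i => Λ '' gens n (2 * L) i) ?_ (Λ U) (Λ V)
    (fun i => (((-(Real.pi * i.1 / L) ^ 2 -
        (gam n α + (i.2 : ℝ) * ((n : ℝ) - 2 + (i.2 : ℝ))) : ℝ) : ℂ) -
      Complex.I * (((α - 2) * (Real.pi * i.1 / L) : ℝ) : ℂ))) hc
    (fun i => norm_s_bound hn α _ i.2 (hck i.2)) ?_ ?_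
  · have nU : ‖Λ U‖ ^ 2 = ∫ x, ‖x‖ ^ (α - 4) * (u x) ^ 2 := by
      have h1 : inner ℂ (Λ U) (Λ U) = ((‖Λ U‖ : ℝ) : ℂ) ^ 2 := inner_self_eq_norm_sq_to_K _
      rw [hin, hUn] at h1
      have e : 2 * ((α - 4 + n) / 2) - n = α - 4 := by ring
      rw [e] at h1
      exact_mod_cast h1.symm
    have nV : ‖Λ V‖ ^ 2 = ∫ x, ‖x‖ ^ α * (lap u x) ^ 2 := by
      have h1 : inner ℂ (Λ V) (Λ V) = ((‖Λ V‖ : ℝ) : ℂ) ^ 2 := inner_self_eq_norm_sq_to_K _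
      rw [hin, hVn] at h1
      have e : 2 * ((α + n) / 2) - n = α := by ring
      rw [e] at h1
      exact_mod_cast h1.symm
    rw [← nU, ← nV, ← mul_pow]
    exact pow_le_pow_left₀ (by positivity) key 2
  · rintro i j hij _ ⟨f, hf, rfl⟩ _ ⟨g, hg, rfl⟩
    rw [hin]
    exact gens_orth hn (2 * L) i j hij f g hf hg
  · rintro ⟨m, k⟩ _ ⟨f, ⟨h, hh, hl, rfl⟩, rfl⟩
    simp only at hh ⊢
    rw [hin, hin, hUp m k h hh, hVp m k h hh]
    set ω := Real.pi * m / L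
    have hcos : ∀ t : ℝ, HasDerivAt (fun t => Real.cos (ω * t)) (-ω * Real.sin (ω * t)) t := by
      intro t
      have := ((hasDerivAt_id t).const_mul ω).cos
      refine this.congr_deriv ?_
      simp; ring
    have hsin : ∀ t : ℝ, HasDerivAt (fun t => Real.sin (ω * t)) (ω * Real.cos (ω * t)) t := by
      intro t
      have := ((hasDerivAt_id t).const_mul ω).sin
      refine this.congr_deriv ?_
      simp; ring
    have g1 := green_mode α ω hu' hh hl (F := fun t => Real.cos (ω * t))
      (G := fun t => Real.sin (ω * t)) (b := -ω ^ 2) (d := -((α - 2) * ω))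
      (by fun_prop) (by fun_prop) hcos (fun t => (hsin t).const_mul (-ω)) (fun t => by ring)
    have g2 := green_mode α ω hu' hh hl (F := fun t => Real.sin (ω * t))
      (G := fun t => Real.cos (ω * t)) (b := -ω ^ 2) (d := ((α - 2) * ω))
      (by fun_prop) (by fun_prop) hsin (fun t => (hcos t).const_mul (ω)) (fun t => by ring)
    have e1 : (α + n) / 2 - n - k = (α - n) / 2 - k := by ring
    have e2 : (α - 4 + n) / 2 - n - k = (α - n) / 2 - k - 2 := by ring
    rw [e1, e2, g1, g2]
    push_cast
    have hI := Complex.I_mul_I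
    generalize hPc : ∫ x, u x * mode ((α - n) / 2 - k - 2) (fun t => Real.cos (ω * t)) h x = Pc
    generalize hPs : ∫ x, u x * mode ((α - n) / 2 - k - 2) (fun t => Real.sin (ω * t)) h x = Ps
    linear_combination (-((α : ℂ) - 2) * ω * Ps) * hI
  · have hd := gens_dense hn0 (2 * L) U
    have h1 : Λ U ∈ closure (Λ '' (Submodule.span ℂ (⋃ i, gens n (2 * L) i) : Set _)) :=
      image_closure_subset_closure_image Λ.continuous ⟨U, hd, rfl⟩
    refine closure_mono ?_ h1
    rintro _ ⟨f, hf, rfl⟩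
    have h2 := Submodule.mem_map_of_mem (f := Λ.toLinearMap) hf
    rw [Submodule.map_span, image_iUnion] at h2
    exact h2

lemma den_pos {n : ℕ} (α : ℝ) {u : EuclideanSpace ℝ (Fin n) → ℝ}
    (hu : DirichletAdm {(0 : EuclideanSpace ℝ (Fin n))}ᶜ u) (hne : ∃ x, u x ≠ 0) :
    0 < ∫ x, ‖x‖ ^ (α - 4) * (u x) ^ 2 := by
  obtain ⟨hu1, hc, hs⟩ := hu
  obtain ⟨x, hx⟩ := hne
  have hts : tsupport (fun x => u x ^ 2) ⊆ tsupport u :=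
    closure_mono fun y hy h => hy (by simp [h])
  have hcont : Continuous fun x => u x ^ 2 * ‖x‖ ^ (α - 4) := by
    refine cont_mul (hu1.continuous.pow 2) (hts.trans hs) ?_
    intro y hy
    exact (continuous_norm.continuousAt.rpow_const (Or.inl (by simpa using hy))).continuousWithinAt
  have hcs' : HasCompactSupport fun x => u x ^ 2 :=
    hc.of_isClosed_subset (isClosed_tsupport _) hts
  have hcs : HasCompactSupport fun x => u x ^ 2 * ‖x‖ ^ (α - 4) := hcs'.mul_right
  have hx0 : x ≠ 0 := fun h => hs (subset_tsupport u hx) h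
  have : 0 < ∫ x, u x ^ 2 * ‖x‖ ^ (α - 4) := by
    refine hcont.integral_pos_of_hasCompactSupport_nonneg_nonzero hcs (fun y => by positivity)
      (x := x) ?_
    have : 0 < ‖x‖ := norm_pos_iff.mpr hx0
    positivity
  simpa only [mul_comm] using this

lemma exists_min (n : ℕ) (hn : 2 ≤ n) (α : ℝ) : ∃ k0 : ℕ, ∀ k : ℕ,
    |gam n α + (k0 : ℝ) * ((n : ℝ) - 2 + (k0 : ℝ))| ≤
      |gam n α + (k : ℝ) * ((n : ℝ) - 2 + (k : ℝ))| := by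
  have ht : Tendsto (fun k : ℕ => |gam n α + (k : ℝ) * ((n : ℝ) - 2 + (k : ℝ))|) atTop atTop := by
    refine tendsto_abs_atTop_atTop.comp (tendsto_atTop_add_const_left _ _ ?_)
    refine tendsto_atTop_mono (f := fun k : ℕ => (k : ℝ)) (fun k => ?_) tendsto_natCast_atTop_atTop
    have hn' : (2 : ℝ) ≤ n := by exact_mod_cast hn
    rcases Nat.eq_zero_or_pos k with h | h
    · simp [h]
    · have : (1 : ℝ) ≤ k := by exact_mod_cast h
      nlinarith
  rw [← Nat.cofinite_eq_atTop] at ht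
  exact ht.exists_forall_le

lemma lower' {n : ℕ} (hn : 2 ≤ n) (α : ℝ) {k0 : ℕ}
    (hk0 : ∀ k : ℕ, |gam n α + (k0 : ℝ) * ((n : ℝ) - 2 + (k0 : ℝ))| ≤
      |gam n α + (k : ℝ) * ((n : ℝ) - 2 + (k : ℝ))|)
    {u : EuclideanSpace ℝ (Fin n) → ℝ}
    (hu : DirichletAdm {(0 : EuclideanSpace ℝ (Fin n))}ᶜ u) :
    (gam n α + (k0 : ℝ) * ((n : ℝ) - 2 + (k0 : ℝ))) ^ 2 * (∫ x, ‖x‖ ^ (α - 4) * (u x) ^ 2) ≤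
      ∫ x, ‖x‖ ^ α * (lap u x) ^ 2 := by
  rcases (abs_nonneg (gam n α + (k0 : ℝ) * ((n : ℝ) - 2 + (k0 : ℝ)))).eq_or_lt with h | h
  · rw [← sq_abs, ← h]
    simp only [ne_eq, OfNat.ofNat_ne_zero, not_false_eq_true, zero_pow, zero_mul]
    exact integral_nonneg fun x => mul_nonneg (Real.rpow_nonneg (norm_nonneg _) _) (sq_nonneg _)
  · rw [← sq_abs]
    exact lower hn α h hk0 hu

/-- the best Rellich constant `μ_{n,α}` on `ℝⁿ ∖ {0}` equals
`min_{k ≥ 0} |γ_{n,α} + k(n-2+k)|²`; the Rellich inequality holds with this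
constant and it is the largest possible one. -/
theorem rellich_whole_space {n : ℕ} (hn : 2 ≤ n) (α : ℝ) :
    IsLeast {v : ℝ | ∃ k : ℕ, v = (gam n α + (k : ℝ) * ((n : ℝ) - 2 + (k : ℝ))) ^ 2}
      (sInf (RellichRatioSet n α)) ∧
    (∀ u : EuclideanSpace ℝ (Fin n) → ℝ,
      DirichletAdm {(0 : EuclideanSpace ℝ (Fin n))}ᶜ u →
      sInf (RellichRatioSet n α) * (∫ x, ‖x‖ ^ (α - 4) * (u x) ^ 2) ≤
        ∫ x, ‖x‖ ^ α * (lap u x) ^ 2) ∧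
    (∀ c : ℝ,
      (∀ u : EuclideanSpace ℝ (Fin n) → ℝ,
        DirichletAdm {(0 : EuclideanSpace ℝ (Fin n))}ᶜ u →
        c * (∫ x, ‖x‖ ^ (α - 4) * (u x) ^ 2) ≤ ∫ x, ‖x‖ ^ α * (lap u x) ^ 2) →
      c ≤ sInf (RellichRatioSet n α)) := by
  obtain ⟨k0, hk0⟩ := exists_min n hn α
  have hmax : ∀ c : ℝ,
      (∀ u : EuclideanSpace ℝ (Fin n) → ℝ,
        DirichletAdm {(0 : EuclideanSpace ℝ (Fin n))}ᶜ u →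
        c * (∫ x, ‖x‖ ^ (α - 4) * (u x) ^ 2) ≤ ∫ x, ‖x‖ ^ α * (lap u x) ^ 2) →
      c ≤ sInf (RellichRatioSet n α) := by
    intro c hc
    refine le_csInf (ratio_nonempty hn α) ?_
    rintro q ⟨u, hu, hne, rfl⟩
    rw [le_div_iff₀ (den_pos α hu hne)]
    exact hc u hu
  have heq : sInf (RellichRatioSet n α) =
      (gam n α + (k0 : ℝ) * ((n : ℝ) - 2 + (k0 : ℝ))) ^ 2 :=
    le_antisymm (upper hn α k0) (hmax _ fun u hu => lower' hn α hk0 hu)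
  refine ⟨⟨⟨k0, heq⟩, ?_⟩, ?_, hmax⟩
  · rintro v ⟨k, rfl⟩
    exact upper hn α k
  · intro u hu
    rw [heq]
    exact lower' hn α hk0 hu

end
end

section
/- Let n ≥ 2 and α ∈ ℝ. Then the infimum of ∫_{ℝⁿ} |x|^α |Δu|² dx / ∫_{ℝⁿ} |x|^{α−4} |u|² dx over all nonzero radial functions u ∈ C²_c(ℝⁿ∖{0}) (i.e. u(x) depends only on |x|) equals γ_{n,α}² = ( ((n−2)/2)² − ((α−2)/2)² )². -/
open MeasureTheory Metric Set Filter
open scoped RealInnerProductSpace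

noncomputable section

/-- Laplacian of a function of `log ‖x‖`. -/
lemma lap_of_log {n : ℕ} {u : EuclideanSpace ℝ (Fin n) → ℝ} {W W1 W2 : ℝ → ℝ}
    (h1 : ∀ s, HasDerivAt W (W1 s) s) (h2 : ∀ s, HasDerivAt W1 (W2 s) s)
    (hc : ContDiff ℝ 2 u) (hu : ∀ y, y ≠ 0 → u y = W (Real.log ‖y‖))
    {x : EuclideanSpace ℝ (Fin n)} (hx : x ≠ 0) :
    lap u x = (W2 (Real.log ‖x‖) + ((n : ℝ) - 2) * W1 (Real.log ‖x‖)) / ‖x‖ ^ 2 := by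
  have hlog : ∀ y : EuclideanSpace ℝ (Fin n), y ≠ 0 →
      HasFDerivAt (fun z : EuclideanSpace ℝ (Fin n) => Real.log ‖z‖)
        ((1 / ‖y‖ ^ 2) • innerSL ℝ y) y := by
    intro y hy
    have hy2 : ‖y‖ ^ 2 ≠ 0 := by positivity
    have := ((hasStrictFDerivAt_norm_sq y).hasFDerivAt.log hy2).const_mul (1 / 2 : ℝ)
    refine (this.congr_fderiv ?_).congr_of_eventuallyEq (Filter.Eventually.of_forall fun z => ?_)
    · ext z
      simp
      ring
    · simp only [Real.log_pow]
      push_cast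
      ring
  have hd : ∀ y : EuclideanSpace ℝ (Fin n), y ≠ 0 →
      HasFDerivAt u (W1 (Real.log ‖y‖) • (1 / ‖y‖ ^ 2) • innerSL ℝ y) y := by
    intro y hy
    have := (h1 (Real.log ‖y‖)).comp_hasFDerivAt y (hlog y hy)
    refine this.congr_of_eventuallyEq ?_
    filter_upwards [isOpen_ne.mem_nhds hy] with z hz
    exact hu z hz
  have hfd : DifferentiableAt ℝ (fderiv ℝ u) x :=
    (hc.fderiv_right (m := 1) (by norm_num)).differentiable (by norm_num) x
  have key : ∀ v : EuclideanSpace ℝ (Fin n), fderiv ℝ (fderiv ℝ u) x v v =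
      W2 (Real.log ‖x‖) * (inner ℝ x v) ^ 2 / ‖x‖ ^ 4 +
        W1 (Real.log ‖x‖) * (‖v‖ ^ 2 / ‖x‖ ^ 2 - 2 * (inner ℝ x v) ^ 2 / ‖x‖ ^ 4) := by
    intro v
    have hx2 : ‖x‖ ^ 2 ≠ 0 := by positivity
    have e1 : HasFDerivAt (fun y => fderiv ℝ u y v)
        ((ContinuousLinearMap.apply ℝ ℝ v).comp (fderiv ℝ (fderiv ℝ u) x)) x :=
      (ContinuousLinearMap.apply ℝ ℝ v).hasFDerivAt.comp x hfd.hasFDerivAt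
    have a1 := (h2 (Real.log ‖x‖)).comp_hasFDerivAt x (hlog x hx)
    have a2 : HasFDerivAt (fun y : EuclideanSpace ℝ (Fin n) => inner ℝ y v) (innerSL ℝ v) x := by
      have := (innerSL ℝ v).hasFDerivAt (x := x)
      refine this.congr_of_eventuallyEq (Filter.Eventually.of_forall fun y => ?_)
      simp [real_inner_comm]
    have a3 := (hasDerivAt_inv hx2).comp_hasFDerivAt x (hasStrictFDerivAt_norm_sq x).hasFDerivAt
    have e2 := (a1.mul a3).mul a2
    have e3 := e2.congr_of_eventuallyEq (f₁ := fun y => fderiv ℝ u y v) (by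
      filter_upwards [isOpen_ne.mem_nhds hx] with y hy
      rw [(hd y hy).fderiv]
      simp
      ring)
    have := DFunLike.congr_fun (e1.unique e3) v
    simp at this
    rw [this, real_inner_comm v x]
    have : inner ℝ x x = ‖x‖ ^ 2 := real_inner_self_eq_norm_sq x
    have hx0 : ‖x‖ ≠ 0 := by positivity
    field_simp
    ring
  unfold lap
  have hx0 : ‖x‖ ≠ 0 := by positivity
  simp only [iteratedFDeriv_two_apply, Matrix.cons_val_zero, Matrix.cons_val_one, key]
  have hs : ∑ i : Fin n, (inner ℝ x (EuclideanSpace.single i (1 : ℝ))) ^ 2 = ‖x‖ ^ 2 := by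
    rw [EuclideanSpace.norm_sq_eq]
    refine Finset.sum_congr rfl fun i _ => ?_
    simp [EuclideanSpace.inner_single_right]
  have : ∀ i : Fin n, W2 (Real.log ‖x‖) * (inner ℝ x (EuclideanSpace.single i (1 : ℝ))) ^ 2 / ‖x‖ ^ 4 +
        W1 (Real.log ‖x‖) * (‖EuclideanSpace.single i (1 : ℝ)‖ ^ 2 / ‖x‖ ^ 2 - 2 * (inner ℝ x (EuclideanSpace.single i (1 : ℝ))) ^ 2 / ‖x‖ ^ 4) =
        (W2 (Real.log ‖x‖) / ‖x‖ ^ 4 - 2 * W1 (Real.log ‖x‖) / ‖x‖ ^ 4) * (inner ℝ x (EuclideanSpace.single i (1 : ℝ))) ^ 2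
        + W1 (Real.log ‖x‖) / ‖x‖ ^ 2 := by
    intro i
    simp only [PiLp.norm_single, norm_one]
    ring
  rw [Finset.sum_congr rfl fun i _ => this i, Finset.sum_add_distrib, ← Finset.mul_sum, hs]
  simp
  field_simp
  ring

/-- Polar coordinates followed by `r = exp s`. -/
lemma integral_norm_exp {n : ℕ} (hn : 2 ≤ n) (f : ℝ → ℝ) :
    ∫ x : EuclideanSpace ℝ (Fin n), f ‖x‖ =
      ((n : ℝ) * (volume : Measure (EuclideanSpace ℝ (Fin n))).real (ball 0 1)) *
        ∫ s : ℝ, Real.exp ((n : ℝ) * s) * f (Real.exp s) := by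
  have : Nonempty (Fin n) := ⟨⟨0, by omega⟩⟩
  rw [integral_fun_norm_addHaar]
  simp only [finrank_euclideanSpace, Fintype.card_fin, nsmul_eq_mul, smul_eq_mul]
  rw [mul_assoc]
  congr 2
  have := integral_image_eq_integral_abs_deriv_smul (s := univ) (f := Real.exp) (f' := Real.exp)
    MeasurableSet.univ (fun x _ => (Real.hasDerivAt_exp x).hasDerivWithinAt)
    Real.exp_injective.injOn (fun y => y ^ (n - 1) * f y)
  rw [image_univ, Real.range_exp, setIntegral_univ] at this
  rw [this]
  refine integral_congr_ae (Filter.Eventually.of_forall fun s => ?_)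
  simp only [abs_of_pos (Real.exp_pos s), smul_eq_mul]
  rw [← mul_assoc, ← pow_succ', Nat.sub_add_cancel (by omega), Real.exp_nat_mul]

lemma const_pos {n : ℕ} (hn : 2 ≤ n) :
    0 < (n : ℝ) * (volume : Measure (EuclideanSpace ℝ (Fin n))).real (ball 0 1) := by
  have : 0 < (volume : Measure (EuclideanSpace ℝ (Fin n))).real (ball 0 1) :=
    ENNReal.toReal_pos (measure_ball_pos _ _ one_pos).ne' measure_ball_lt_top.ne
  have : (0 : ℝ) < n := by exact_mod_cast (by omega : 0 < n)
  positivity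

/-- One-dimensional identity. -/
lemma one_dim {w w1 w2 : ℝ → ℝ} (h1 : ∀ s, HasDerivAt w (w1 s) s)
    (h2 : ∀ s, HasDerivAt w1 (w2 s) s) (h3 : Continuous w2) (hw : HasCompactSupport w)
    (a g : ℝ) :
    ∫ s, (w2 s + a * w1 s - g * w s) ^ 2 =
      (∫ s, w2 s ^ 2) + (a ^ 2 + 2 * g) * (∫ s, w1 s ^ 2) + g ^ 2 * ∫ s, w s ^ 2 := by
  have e1 : deriv w = w1 := funext fun s => (h1 s).deriv
  have e2 : deriv w1 = w2 := funext fun s => (h2 s).deriv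
  have hw1 : HasCompactSupport w1 := e1 ▸ hw.deriv
  have hw2 : HasCompactSupport w2 := e2 ▸ hw1.deriv
  have c0 : Continuous w := continuous_iff_continuousAt.2 fun s => (h1 s).continuousAt
  have c1 : Continuous w1 := continuous_iff_continuousAt.2 fun s => (h2 s).continuousAt
  have int : ∀ {p q : ℝ → ℝ}, Continuous p → Continuous q → HasCompactSupport p →
      Integrable (fun s => p s * q s) := fun hp hq hs =>
    (hp.mul hq).integrable_of_hasCompactSupport (hs.mul_right)
  have i00 := int c0 c0 hw
  have i01 := int c0 c1 hw
  have i02 := int c0 h3 hw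
  have i11 := int c1 c1 hw1
  have i12 := int c1 h3 hw1
  have i22 := int h3 h3 hw2
  have z := integral_eq_zero_of_hasDerivAt_of_integrable
    (f := fun s => a * (w1 s * w1 s) - a * g * (w s * w s) - 2 * g * (w s * w1 s))
    (f' := fun s => 2 * a * (w1 s * w2 s) - 2 * a * g * (w s * w1 s)
      - 2 * g * (w1 s * w1 s) - 2 * g * (w s * w2 s))
    (fun s => by
      have := ((((h2 s).mul (h2 s)).const_mul a).sub (((h1 s).mul (h1 s)).const_mul (a * g))).sub
        (((h1 s).mul (h2 s)).const_mul (2 * g))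
      exact this.congr_deriv (by ring))
    ((((i12.const_mul _).sub (i01.const_mul _)).sub (i11.const_mul _)).sub (i02.const_mul _))
    (((i11.const_mul _).sub (i00.const_mul _)).sub (i01.const_mul _))
  have hz : Integrable (fun s => 2 * a * (w1 s * w2 s) - 2 * a * g * (w s * w1 s)
      - 2 * g * (w1 s * w1 s) - 2 * g * (w s * w2 s)) :=
    ((((i12.const_mul _).sub (i01.const_mul _)).sub (i11.const_mul _)).sub (i02.const_mul _))
  have j1 : Integrable (fun s => w2 s * w2 s + (a ^ 2 + 2 * g) * (w1 s * w1 s)) :=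
    i22.add (i11.const_mul _)
  have j2 : Integrable (fun s => w2 s * w2 s + (a ^ 2 + 2 * g) * (w1 s * w1 s)
      + g ^ 2 * (w s * w s)) := j1.add (i00.const_mul _)
  have : (fun s => (w2 s + a * w1 s - g * w s) ^ 2) = fun s =>
      ((w2 s * w2 s + (a ^ 2 + 2 * g) * (w1 s * w1 s)) + g ^ 2 * (w s * w s)) +
      (2 * a * (w1 s * w2 s) - 2 * a * g * (w s * w1 s)
      - 2 * g * (w1 s * w1 s) - 2 * g * (w s * w2 s)) := by
    ext s; ring
  rw [this, integral_add j2 hz, z,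
    integral_add j1 (i00.const_mul _),
    integral_add i22 (i11.const_mul _), integral_const_mul, integral_const_mul]
  simp only [pow_two, add_zero]

/-- Numerator and denominator in the Emden-Fowler variable. -/
lemma num_den {n : ℕ} (hn : 2 ≤ n) (α : ℝ) {u : EuclideanSpace ℝ (Fin n) → ℝ}
    {w w1 w2 : ℝ → ℝ} (h1 : ∀ s, HasDerivAt w (w1 s) s) (h2 : ∀ s, HasDerivAt w1 (w2 s) s)
    (hc : ContDiff ℝ 2 u)
    (hu : ∀ y, y ≠ 0 → u y = Real.exp ((4 - n - α) / 2 * Real.log ‖y‖) * w (Real.log ‖y‖)) :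
    (∫ x, ‖x‖ ^ α * (lap u x) ^ 2 =
      ((n : ℝ) * (volume : Measure (EuclideanSpace ℝ (Fin n))).real (ball 0 1)) *
        ∫ s, (w2 s + (2 - α) * w1 s - gam n α * w s) ^ 2) ∧
    (∫ x, ‖x‖ ^ (α - 4) * (u x) ^ 2 =
      ((n : ℝ) * (volume : Measure (EuclideanSpace ℝ (Fin n))).real (ball 0 1)) *
        ∫ s, w s ^ 2) := by
  have : Nonempty (Fin n) := ⟨⟨0, by omega⟩⟩
  set b : ℝ := (4 - n - α) / 2 with hb
  have hexp : ∀ s, HasDerivAt (fun s => Real.exp (b * s)) (b * Real.exp (b * s)) s := fun s => by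
    have := ((hasDerivAt_id s).const_mul b).exp
    exact this.congr_deriv (by simp; ring)
  have H1 : ∀ s, HasDerivAt (fun s => Real.exp (b * s) * w s)
      (Real.exp (b * s) * (w1 s + b * w s)) s := fun s => by
    exact ((hexp s).mul (h1 s)).congr_deriv (by ring)
  have H2 : ∀ s, HasDerivAt (fun s => Real.exp (b * s) * (w1 s + b * w s))
      (Real.exp (b * s) * (w2 s + 2 * b * w1 s + b ^ 2 * w s)) s := fun s => by
    exact ((hexp s).mul ((h2 s).add ((h1 s).const_mul b))).congr_deriv (by simp only [Pi.add_apply]; ring)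
  have hae : ∀ᵐ x : EuclideanSpace ℝ (Fin n), x ≠ 0 := by
    rw [ae_iff]
    simp
  constructor
  · refine Eq.trans (integral_congr_ae ?_) ((integral_norm_exp hn (fun r : ℝ => r ^ α *
      ((Real.exp (b * Real.log r) * (w2 (Real.log r) + 2 * b * w1 (Real.log r) +
        b ^ 2 * w (Real.log r)) + ((n : ℝ) - 2) * (Real.exp (b * Real.log r) *
          (w1 (Real.log r) + b * w (Real.log r)))) / r ^ 2) ^ 2)).trans ?_)
    rotate_left
    · congr 2
      ext s
      simp only [Real.log_exp]
      have e : Real.exp (n * s) * Real.exp s ^ α * (Real.exp (b * s)) ^ 2 / (Real.exp s ^ 2) ^ 2 = 1 := by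
        rw [← Real.exp_mul, ← Real.exp_nat_mul, ← Real.exp_nat_mul, ← Real.exp_nat_mul,
          ← Real.exp_add, ← Real.exp_add, ← Real.exp_sub, Real.exp_eq_one_iff]
        push_cast
        rw [hb]; ring
      calc _ = (Real.exp (n * s) * Real.exp s ^ α * (Real.exp (b * s)) ^ 2 / (Real.exp s ^ 2) ^ 2) *
            ((w2 s + 2 * b * w1 s + b ^ 2 * w s) + ((n : ℝ) - 2) * (w1 s + b * w s)) ^ 2 := by ring
        _ = _ := by
          rw [e, one_mul, hb, gam]
          congr 1
          ring
    · filter_upwards [hae] with x hx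
      rw [lap_of_log H1 H2 hc hu hx]
  · refine Eq.trans (integral_congr_ae ?_) ((integral_norm_exp hn (fun r : ℝ => r ^ (α - 4) *
      (Real.exp (b * Real.log r) * w (Real.log r)) ^ 2)).trans ?_)
    rotate_left
    · congr 2
      ext s
      simp only [Real.log_exp]
      have e : Real.exp (n * s) * Real.exp s ^ (α - 4) * (Real.exp (b * s)) ^ 2 = 1 := by
        rw [← Real.exp_mul, ← Real.exp_nat_mul,
          ← Real.exp_add, ← Real.exp_add, Real.exp_eq_one_iff]
        push_cast
        rw [hb]; ring
      calc _ = (Real.exp (n * s) * Real.exp s ^ (α - 4) * (Real.exp (b * s)) ^ 2) *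
            w s ^ 2 := by ring
        _ = _ := by
          rw [e, one_mul]
    · filter_upwards [hae] with x hx
      rw [hu x hx]

lemma derivs_of_contDiff {w : ℝ → ℝ} (hw : ContDiff ℝ 2 w) :
    (∀ s, HasDerivAt w (deriv w s) s) ∧ (∀ s, HasDerivAt (deriv w) (deriv (deriv w) s) s) ∧
      Continuous (deriv (deriv w)) := by
  have h1 : ContDiff ℝ 1 (deriv w) := by
    have : ContDiff ℝ (1 + 1) w := by simpa [one_add_one_eq_two] using hw
    exact (contDiff_succ_iff_deriv.1 this).2.2
  refine ⟨fun s => (hw.differentiable (by norm_num) s).hasDerivAt,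
    fun s => (h1.differentiable (by norm_num) s).hasDerivAt, ?_⟩
  exact h1.continuous_deriv (by norm_num)

lemma exists_u {n : ℕ} (hn : 2 ≤ n) (b : ℝ) {w : ℝ → ℝ} (hw : ContDiff ℝ 2 w)
    (hs : HasCompactSupport w) (hne : ∃ s, w s ≠ 0) :
    ∃ u : EuclideanSpace ℝ (Fin n) → ℝ,
      DirichletAdm {(0 : EuclideanSpace ℝ (Fin n))}ᶜ u ∧
      (∃ g : ℝ → ℝ, ∀ x, u x = g ‖x‖) ∧ (∃ x, u x ≠ 0) ∧
      ∀ y, y ≠ 0 → u y = Real.exp (b * Real.log ‖y‖) * w (Real.log ‖y‖) := by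
  classical
  obtain ⟨R, hR⟩ := hs.isCompact.isBounded.subset_closedBall (0 : ℝ)
  have hR' : ∀ s, w s ≠ 0 → |s| ≤ R := fun s h => by
    have := hR (subset_tsupport w h)
    simpa using this
  set g : ℝ → ℝ := fun r => if r = 0 then 0 else Real.exp (b * Real.log r) * w (Real.log r)
    with hg
  have hu : ∀ y : EuclideanSpace ℝ (Fin n), y ≠ 0 →
      g ‖y‖ = Real.exp (b * Real.log ‖y‖) * w (Real.log ‖y‖) := fun y hy => by
    simp [hg, hy]
  have hb : ∀ y : EuclideanSpace ℝ (Fin n), g ‖y‖ ≠ 0 →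
      Real.exp (-R) ≤ ‖y‖ ∧ ‖y‖ ≤ Real.exp R := by
    intro y hy
    have y0 : y ≠ 0 := by
      rintro rfl
      simp [hg] at hy
    rw [hu y y0] at hy
    have := abs_le.1 (hR' _ (right_ne_zero_of_mul hy))
    have p : 0 < ‖y‖ := norm_pos_iff.2 y0
    exact ⟨(Real.le_log_iff_exp_le p).1 this.1, (Real.log_le_iff_le_exp p).1 this.2⟩
  have hK : tsupport (fun y : EuclideanSpace ℝ (Fin n) => g ‖y‖) ⊆
      {y | Real.exp (-R) ≤ ‖y‖} ∩ closedBall 0 (Real.exp R) := by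
    refine closure_minimal (fun y hy => ?_) ?_
    · exact ⟨(hb y hy).1, by simpa using (hb y hy).2⟩
    · exact (isClosed_le continuous_const continuous_norm).inter isClosed_closedBall
  refine ⟨fun y => g ‖y‖, ⟨?_, ?_, ?_⟩, ⟨g, fun _ => rfl⟩, ?_, hu⟩
  · rw [contDiff_iff_contDiffAt]
    intro x
    by_cases hx : x = 0
    · subst hx
      refine (contDiffAt_const (c := (0 : ℝ))).congr_of_eventuallyEq ?_
      filter_upwards [ball_mem_nhds (0 : EuclideanSpace ℝ (Fin n)) (Real.exp_pos (-R))] with y hy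
      by_contra h
      have := (hb y h).1
      simp at hy
      linarith
    · have l : ContDiffAt ℝ 2 (fun y : EuclideanSpace ℝ (Fin n) => Real.log ‖y‖) x :=
        (contDiffAt_norm ℝ hx).log (by simpa using hx)
      have : ContDiffAt ℝ 2 (fun y : EuclideanSpace ℝ (Fin n) =>
          Real.exp (b * Real.log ‖y‖) * w (Real.log ‖y‖)) x :=
        ((contDiffAt_const.mul l).exp).mul (hw.contDiffAt.comp x l)
      refine this.congr_of_eventuallyEq ?_
      filter_upwards [isOpen_ne.mem_nhds hx] with z hz
      exact hu z hz
  · exact ((isCompact_closedBall _ _).of_isClosed_subset (isClosed_tsupport _)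
      (hK.trans inter_subset_right))
  · intro y hy h0
    have := (hK hy).1
    rw [mem_singleton_iff.1 h0] at this
    simp at this
    linarith [Real.exp_pos (-R)]
  · obtain ⟨s, hs⟩ := hne
    let e : EuclideanSpace ℝ (Fin n) := EuclideanSpace.single ⟨0, by omega⟩ 1
    have he : ‖Real.exp s • e‖ = Real.exp s := by
      rw [norm_smul]; simp [e]
    refine ⟨Real.exp s • e, ?_⟩
    have h0 : Real.exp s • e ≠ 0 := by
      rw [← norm_pos_iff, he]; exact Real.exp_pos s
    change g ‖Real.exp s • e‖ ≠ 0
    rw [hu _ h0, he, Real.log_exp]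
    exact mul_ne_zero (Real.exp_pos _).ne' hs

lemma exists_w {n : ℕ} (hn : 2 ≤ n) (b : ℝ) {u : EuclideanSpace ℝ (Fin n) → ℝ}
    (hA : DirichletAdm {(0 : EuclideanSpace ℝ (Fin n))}ᶜ u)
    (hr : ∃ g : ℝ → ℝ, ∀ x, u x = g ‖x‖) (hne : ∃ x, u x ≠ 0) :
    ∃ w : ℝ → ℝ, ContDiff ℝ 2 w ∧ HasCompactSupport w ∧ (∃ s, w s ≠ 0) ∧
      ∀ y, y ≠ 0 → u y = Real.exp (b * Real.log ‖y‖) * w (Real.log ‖y‖) := by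
  obtain ⟨hc, hcs, h0⟩ := hA
  obtain ⟨g, hg⟩ := hr
  let e : EuclideanSpace ℝ (Fin n) := EuclideanSpace.single ⟨0, by omega⟩ 1
  have he : ∀ s, ‖Real.exp s • e‖ = Real.exp s := fun s => by
    rw [norm_smul]; simp [e]
  have hu : ∀ y, y ≠ 0 → u y = Real.exp (b * Real.log ‖y‖) *
      (Real.exp (-(b * Real.log ‖y‖)) * u (Real.exp (Real.log ‖y‖) • e)) := by
    intro y hy
    rw [← mul_assoc, ← Real.exp_add, add_neg_cancel, Real.exp_zero, one_mul, hg, hg, he,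
      Real.exp_log (norm_pos_iff.2 hy)]
  obtain ⟨R, hR⟩ := hcs.isCompact.isBounded.subset_closedBall 0
  have hz : (tsupport u)ᶜ ∈ nhds (0 : EuclideanSpace ℝ (Fin n)) :=
    (isClosed_tsupport u).isOpen_compl.mem_nhds fun h => h0 h rfl
  obtain ⟨ε, hε, hb⟩ := Metric.mem_nhds_iff.1 hz
  refine ⟨fun s => Real.exp (-(b * s)) * u (Real.exp s • e), ?_, ?_, ?_, hu⟩
  · exact ((contDiff_const.mul contDiff_id).neg.exp).mul
      (hc.comp (Real.contDiff_exp.smul contDiff_const))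
  · refine HasCompactSupport.intro (isCompact_Icc (a := Real.log ε) (b := Real.log R)) fun s hs => ?_
    by_contra h
    have h' := subset_tsupport u (right_ne_zero_of_mul h)
    apply hs
    have hR1 : Real.exp s ≤ R := by
      have := hR h'
      rwa [mem_closedBall_zero_iff, he] at this
    have hε1 : ε ≤ Real.exp s := by
      by_contra hlt
      exact hb (by rw [mem_ball_zero_iff, he]; exact not_le.1 hlt) h'
    exact ⟨(Real.log_le_iff_le_exp hε).2 hε1,
      (Real.le_log_iff_exp_le ((Real.exp_pos s).trans_le hR1)).2 hR1⟩
  · obtain ⟨x, hx⟩ := hne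
    have x0 : x ≠ 0 := fun h => h0 (subset_tsupport u hx) h
    refine ⟨Real.log ‖x‖, ?_⟩
    have := hu x x0
    rw [this] at hx
    exact right_ne_zero_of_mul hx

lemma sq_pos_int {w : ℝ → ℝ} (hw : ContDiff ℝ 2 w)
    (hs : HasCompactSupport w) (hne : ∃ s, w s ≠ 0) : 0 < ∫ s, w s ^ 2 := by
  obtain ⟨s, h⟩ := hne
  refine Continuous.integral_pos_of_hasCompactSupport_nonneg_nonzero (x := s)
    (hw.continuous.pow 2) ?_ (fun _ => sq_nonneg _) (pow_ne_zero _ h)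
  simp only [pow_two]
  exact hs.mul_right

/-- Value of the quotient. -/
lemma quot_eq {n : ℕ} (hn : 2 ≤ n) (α : ℝ) {u : EuclideanSpace ℝ (Fin n) → ℝ}
    {w w1 w2 : ℝ → ℝ} (h1 : ∀ s, HasDerivAt w (w1 s) s) (h2 : ∀ s, HasDerivAt w1 (w2 s) s)
    (h3 : Continuous w2) (hs : HasCompactSupport w) (hp : 0 < ∫ s, w s ^ 2)
    (hc : ContDiff ℝ 2 u)
    (hu : ∀ y, y ≠ 0 → u y = Real.exp ((4 - n - α) / 2 * Real.log ‖y‖) * w (Real.log ‖y‖)) :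
    (∫ x, ‖x‖ ^ α * (lap u x) ^ 2) / (∫ x, ‖x‖ ^ (α - 4) * (u x) ^ 2) =
      ((∫ s, w2 s ^ 2) + 2 * gbar n α * (∫ s, w1 s ^ 2)) / (∫ s, w s ^ 2) + gam n α ^ 2 := by
  obtain ⟨e1, e2⟩ := num_den hn α h1 h2 hc hu
  rw [e1, e2, mul_div_mul_left _ _ (const_pos hn).ne', one_dim h1 h2 h3 hs, add_div,
    mul_div_cancel_right₀ _ hp.ne']
  congr 4
  simp only [gam, gbar]
  ring

lemma gbar_nonneg (n : ℕ) (α : ℝ) : 0 ≤ gbar n α := by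
  unfold gbar; positivity

/-- the Rellich quotient restricted to radial functions has
infimum `γ_{n,α}² = (((n-2)/2)² - ((α-2)/2)²)²`. -/
theorem rellich_radial {n : ℕ} (hn : 2 ≤ n) (α : ℝ) :
    sInf {q : ℝ | ∃ u : EuclideanSpace ℝ (Fin n) → ℝ,
        DirichletAdm {(0 : EuclideanSpace ℝ (Fin n))}ᶜ u ∧
        (∃ g : ℝ → ℝ, ∀ x, u x = g ‖x‖) ∧ (∃ x, u x ≠ 0) ∧
        q = (∫ x, ‖x‖ ^ α * (lap u x) ^ 2) / (∫ x, ‖x‖ ^ (α - 4) * (u x) ^ 2)} =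
      ((((n : ℝ) - 2) / 2) ^ 2 - ((α - 2) / 2) ^ 2) ^ 2 := by
  change _ = gam n α ^ 2
  -- a fixed profile
  let φ : ContDiffBump (0 : ℝ) := ⟨1, 2, one_pos, one_lt_two⟩
  have φc : ContDiff ℝ 2 φ := φ.contDiff
  have φs : HasCompactSupport φ := φ.hasCompactSupport
  have φ0 : φ 0 ≠ 0 := (φ.pos_of_mem_ball (by simp [φ])).ne'
  obtain ⟨d1, d2, d3⟩ := derivs_of_contDiff φc
  set A := ∫ s, deriv (deriv φ) s ^ 2
  set B := ∫ s, deriv φ s ^ 2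
  set C := ∫ s, φ s ^ 2 with hC
  have Cpos : 0 < C := sq_pos_int φc φs ⟨0, φ0⟩
  have key : ∀ ε : ℝ, 0 < ε → ∃ u : EuclideanSpace ℝ (Fin n) → ℝ,
        DirichletAdm {(0 : EuclideanSpace ℝ (Fin n))}ᶜ u ∧
        (∃ g : ℝ → ℝ, ∀ x, u x = g ‖x‖) ∧ (∃ x, u x ≠ 0) ∧
        ε ^ 4 * (A / C) + ε ^ 2 * (2 * gbar n α * B / C) + gam n α ^ 2 =
          (∫ x, ‖x‖ ^ α * (lap u x) ^ 2) / (∫ x, ‖x‖ ^ (α - 4) * (u x) ^ 2) := by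
    intro ε hε
    have lin : ∀ s, HasDerivAt (fun s : ℝ => ε * s) ε s := fun s => by
      simpa using (hasDerivAt_id s).const_mul ε
    have h1 : ∀ s, HasDerivAt (fun s => φ (ε * s)) (ε * deriv φ (ε * s)) s := fun s =>
      ((d1 (ε * s)).comp s (lin s)).congr_deriv (by ring)
    have h2 : ∀ s, HasDerivAt (fun s => ε * deriv φ (ε * s))
        (ε * (ε * deriv (deriv φ) (ε * s))) s := fun s =>
      (((d2 (ε * s)).comp s (lin s)).const_mul ε).congr_deriv (by ring)
    have h3 : Continuous fun s => ε * (ε * deriv (deriv φ) (ε * s)) := by fun_prop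
    have hs : HasCompactSupport fun s => φ (ε * s) :=
      φs.comp_homeomorph (Homeomorph.mulLeft₀ ε hε.ne')
    have hc : ContDiff ℝ 2 fun s => φ (ε * s) := φc.comp (contDiff_const.mul contDiff_id)
    have hne : ∃ s, φ (ε * s) ≠ 0 := ⟨0, by simpa using φ0⟩
    obtain ⟨u, hA, hr, hn0, hu⟩ := exists_u hn ((4 - n - α) / 2) hc hs hne
    refine ⟨u, hA, hr, hn0, ?_⟩
    rw [quot_eq hn α h1 h2 h3 hs (sq_pos_int hc hs hne) hA.1 hu]
    have s0 : ∫ s, φ (ε * s) ^ 2 = ε⁻¹ * C := by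
      have := Measure.integral_comp_mul_left (fun s => φ s ^ 2) ε
      simpa [abs_of_pos hε] using this
    have s1 : ∫ s, (ε * deriv φ (ε * s)) ^ 2 = ε ^ 2 * (ε⁻¹ * B) := by
      have := Measure.integral_comp_mul_left (fun s => deriv φ s ^ 2) ε
      simp only [mul_pow, integral_const_mul]
      rw [this]
      simp [abs_of_pos hε, B]
    have s2 : ∫ s, (ε * (ε * deriv (deriv φ) (ε * s))) ^ 2 = ε ^ 2 * (ε ^ 2 * (ε⁻¹ * A)) := by
      have := Measure.integral_comp_mul_left (fun s => deriv (deriv φ) s ^ 2) ε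
      simp only [mul_pow, integral_const_mul]
      rw [this]
      simp [abs_of_pos hε, A]
    rw [s0, s1, s2]
    field_simp
  apply csInf_eq_of_forall_ge_of_forall_gt_exists_lt
  · obtain ⟨u, hA, hr, hn0, hq⟩ := key 1 one_pos
    exact ⟨_, u, hA, hr, hn0, rfl⟩
  · rintro q ⟨u, hA, hr, hn0, rfl⟩
    obtain ⟨w, hw, hs, hne, hu⟩ := exists_w hn ((4 - n - α) / 2) hA hr hn0
    obtain ⟨h1, h2, h3⟩ := derivs_of_contDiff hw
    have hp := sq_pos_int hw hs hne
    rw [quot_eq hn α h1 h2 h3 hs hp hA.1 hu]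
    have i1 : 0 ≤ ∫ s, deriv w s ^ 2 := integral_nonneg fun _ => sq_nonneg _
    have i2 : 0 ≤ ∫ s, deriv (deriv w) s ^ 2 := integral_nonneg fun _ => sq_nonneg _
    have := gbar_nonneg n α
    have : 0 ≤ ((∫ s, deriv (deriv w) s ^ 2) + 2 * gbar n α * (∫ s, deriv w s ^ 2)) /
      (∫ s, w s ^ 2) := by positivity
    linarith
  · intro r hr
    have ht : Tendsto (fun ε : ℝ => ε ^ 4 * (A / C) + ε ^ 2 * (2 * gbar n α * B / C)
        + gam n α ^ 2) (nhdsWithin 0 (Ioi 0)) (nhds (gam n α ^ 2)) := by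
      have : Continuous (fun ε : ℝ => ε ^ 4 * (A / C) + ε ^ 2 * (2 * gbar n α * B / C)
        + gam n α ^ 2) := by fun_prop
      have := this.tendsto 0
      simp only [ne_eq, OfNat.ofNat_ne_zero, not_false_eq_true, zero_pow, zero_mul,
        zero_add] at this
      exact this.mono_left nhdsWithin_le_nhds
    obtain ⟨ε, hε, hε0⟩ := ((ht.eventually (gt_mem_nhds hr)).and self_mem_nhdsWithin).exists
    obtain ⟨u, hA, hr', hn0, hq⟩ := key ε hε0
    exact ⟨_, ⟨u, hA, hr', hn0, hq⟩, hε⟩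

end
end
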